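/- arXiv:2504.06713 — 3 statements merged into one kernel-verified Lean document; each statement's English description precedes it below -/
import Mathlib

section
/- Let α ∈ (-1,∞)^d and β > -2(|α|_1 + d). Then the measure |x|^β dμ_α(x) is doubling on (0,∞)^d: there exists C such that for every x_0 ∈ (0,∞)^d and R > 0, ∫_{B(x_0, 2R)} |x|^β dμ_α(x) ≤ C ∫_{B(x_0, R)} |x|^β dμ_α(x). -/
/-- The measure dμ_α(x) = x₁^{2α₁+1}···x_d^{2α_d+1} dx on (0,∞)^d ⊆ ℝ^d (Euclidean). -/
noncomputable def lagMeasure (d : ℕ) (α : Fin d → ℝ) :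
    MeasureTheory.Measure (EuclideanSpace ℝ (Fin d)) :=
  ((MeasureTheory.volume :
      MeasureTheory.Measure (EuclideanSpace ℝ (Fin d))).restrict {x | ∀ i, 0 < x i}).withDensity
    fun x => ENNReal.ofReal (∏ i, x i ^ (2 * α i + 1))

open MeasureTheory Set

theorem lintegral_fin_prod_eq_prod {n : ℕ} (μ : Fin n → Measure ℝ) [∀ i, SigmaFinite (μ i)]
    {f : Fin n → ℝ → ENNReal} (hf : ∀ i, Measurable (f i)) :
    ∫⁻ x, ∏ i, f i (x i) ∂(Measure.pi μ) = ∏ i, ∫⁻ t, f i t ∂(μ i) := by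
  induction n with
  | zero => simp
  | succ n ih =>
    rw [← (measurePreserving_piFinSuccAbove μ 0).symm.lintegral_comp_emb
      (MeasurableEquiv.measurableEmbedding _)]
    simp_rw [MeasurableEquiv.piFinSuccAbove_symm_apply, Fin.insertNthEquiv,
      Fin.prod_univ_succ, Fin.insertNth_zero, Equiv.coe_fn_mk, Fin.cons_succ,
      Fin.zero_succAbove, Fin.cons_zero]
    rw [← ih (fun i : Fin n => μ i.succ) fun i => hf i.succ]
    exact lintegral_prod_mul (hf 0).aemeasurable
      (Finset.measurable_prod _ fun (i : Fin n) _ => (hf i.succ).comp (measurable_pi_apply i)).aemeasurable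

theorem setLIntegral_box_prod_eq_prod {d : ℕ} (S : Fin d → Set ℝ)
    {f : Fin d → ℝ → ENNReal} (hf : ∀ i, Measurable (f i)) :
    ∫⁻ x in {x : EuclideanSpace ℝ (Fin d) | ∀ i, x i ∈ S i}, ∏ i, f i (x i) =
      ∏ i, ∫⁻ t in S i, f i t := by
  rw [← lintegral_fin_prod_eq_prod _ hf, ← Measure.restrict_pi_pi, ← volume_pi,
    ← (EuclideanSpace.volume_preserving_symm_measurableEquiv_toLp
      (Fin d)).setLIntegral_comp_preimage_emb (MeasurableEquiv.measurableEmbedding _)]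
  congr 2
  ext x
  simp

theorem min_rpow_mul_le_rpow {p q u R : ℝ} (b : ℝ) (hp : 0 < p) (hR : 0 < R)
    (hpu : p * R ≤ u) (huq : u ≤ q * R) : min (p ^ b) (q ^ b) * R ^ b ≤ u ^ b := by
  have hu : 0 < u := (mul_pos hp hR).trans_le hpu
  have hq : 0 < q := by
    by_contra! h
    nlinarith
  rcases le_total 0 b with hb | hb
  · calc _ ≤ p ^ b * R ^ b := by gcongr; exact min_le_left _ _
      _ = (p * R) ^ b := (Real.mul_rpow hp.le hR.le).symm
      _ ≤ u ^ b := Real.rpow_le_rpow (by positivity) hpu hb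
  · calc _ ≤ q ^ b * R ^ b := by gcongr; exact min_le_right _ _
      _ = (q * R) ^ b := (Real.mul_rpow hq.le hR.le).symm
      _ ≤ u ^ b := Real.rpow_le_rpow_of_nonpos hu huq hb

theorem rpow_le_max_rpow_mul {p q u R : ℝ} (b : ℝ) (hp : 0 < p) (hR : 0 < R)
    (hpu : p * R ≤ u) (huq : u ≤ q * R) : u ^ b ≤ max (p ^ b) (q ^ b) * R ^ b := by
  have hu : 0 < u := (mul_pos hp hR).trans_le hpu
  have hq : 0 < q := by
    by_contra! h
    nlinarith
  rcases le_total 0 b with hb | hb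
  · calc u ^ b ≤ (q * R) ^ b := Real.rpow_le_rpow hu.le huq hb
      _ = q ^ b * R ^ b := Real.mul_rpow hq.le hR.le
      _ ≤ _ := by gcongr; exact le_max_right _ _
  · calc u ^ b ≤ (p * R) ^ b := Real.rpow_le_rpow_of_nonpos (by positivity) hpu hb
      _ = p ^ b * R ^ b := Real.mul_rpow hp.le hR.le
      _ ≤ _ := by gcongr; exact le_max_left _ _

theorem ofReal_mul_le_setLIntegral_Ioo {f : ℝ → ℝ} {p q k : ℝ} (hk : 0 ≤ k)
    (h : ∀ t ∈ Ioo p q, k ≤ f t) :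
    ENNReal.ofReal (k * (q - p)) ≤ ∫⁻ t in Ioo p q, ENNReal.ofReal (f t) := by
  rw [ENNReal.ofReal_mul hk, ← Real.volume_Ioo, ← setLIntegral_const]
  exact setLIntegral_mono' measurableSet_Ioo fun t ht => ENNReal.ofReal_le_ofReal (h t ht)

theorem setLIntegral_Ioo_le_ofReal_mul {f : ℝ → ℝ} {p q k : ℝ} (hk : 0 ≤ k)
    (h : ∀ t ∈ Ioo p q, f t ≤ k) :
    ∫⁻ t in Ioo p q, ENNReal.ofReal (f t) ≤ ENNReal.ofReal (k * (q - p)) := by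
  rw [ENNReal.ofReal_mul hk, ← Real.volume_Ioo, ← setLIntegral_const]
  exact setLIntegral_mono' measurableSet_Ioo fun t ht => ENNReal.ofReal_le_ofReal (h t ht)

theorem setLIntegral_Ioo_zero_rpow {b M : ℝ} (hb : -1 < b) (hM : 0 < M) :
    ∫⁻ t in Ioo 0 M, ENNReal.ofReal (t ^ b) = ENNReal.ofReal (M ^ (b + 1) / (b + 1)) := by
  rw [← ofReal_integral_eq_lintegral_ofReal
    ((intervalIntegral.integrableOn_Ioo_rpow_iff hM).2 hb), ← integral_Ioc_eq_integral_Ioo,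
    ← intervalIntegral.integral_of_le hM.le, integral_rpow (Or.inl hb),
    Real.zero_rpow (by linarith), sub_zero]
  filter_upwards [ae_restrict_mem measurableSet_Ioo] with t ht
  exact Real.rpow_nonneg ht.1.le _

theorem exists_setLIntegral_Ioo_zero_rpow_le {a γ n : ℝ} (h : -1 < a + γ) (hn : 1 ≤ n) :
    ∃ c : ℝ, 0 < c ∧ ∀ s R : ℝ, 0 < s → 0 < R → s ≤ 4 * R →
      ∫⁻ t in Ioo 0 (6 * R), ENNReal.ofReal (t ^ (a + γ)) ≤
        ENNReal.ofReal (c * R ^ γ) *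
          ∫⁻ t in Ioo (s + R / (2 * n)) (s + R / n), ENNReal.ofReal (t ^ a) := by
  have hn0 : 0 < n := by linarith
  have hb : 0 < a + γ + 1 := by linarith
  set m : ℝ := min ((1 / (2 * n)) ^ a) (5 ^ a)
  have hm : 0 < m := lt_min (by positivity) (by positivity)
  refine ⟨6 ^ (a + γ + 1) / (a + γ + 1) / (m / (2 * n)), by positivity, fun s R hs hR hsR => ?_⟩
  have key := ofReal_mul_le_setLIntegral_Ioo (f := fun t => t ^ a) (p := s + R / (2 * n))
    (q := s + R / n) (k := m * R ^ a) (by positivity) fun t ht => by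
      refine min_rpow_mul_le_rpow a (by positivity) hR ?_ ?_
      · have := ht.1
        rw [one_div_mul_eq_div]
        linarith
      · have := ht.2
        have : R / n ≤ R := div_le_self hR.le hn
        linarith
  refine le_trans ?_ (mul_le_mul_right key _)
  rw [setLIntegral_Ioo_zero_rpow h (by positivity), ← ENNReal.ofReal_mul (by positivity)]
  refine ENNReal.ofReal_le_ofReal (le_of_eq ?_)
  rw [Real.mul_rpow (by norm_num) hR.le, Real.rpow_add_one hR.ne', Real.rpow_add hR]
  field_simp
  ring

theorem exists_setLIntegral_Ioo_inter_Ioi_rpow_le {a n : ℝ} (ha : -1 < a) (hn : 1 ≤ n) :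
    ∃ c : ℝ, 0 < c ∧ ∀ s R : ℝ, 0 < s → 0 < R →
      ∫⁻ t in Ioo (s - 2 * R) (s + 2 * R) ∩ Ioi 0, ENNReal.ofReal (t ^ a) ≤
        ENNReal.ofReal c *
          ∫⁻ t in Ioo (s + R / (2 * n)) (s + R / n), ENNReal.ofReal (t ^ a) := by
  have hn0 : 0 < n := by linarith
  obtain ⟨c, hc, H⟩ := exists_setLIntegral_Ioo_zero_rpow_le (a := a) (γ := 0) (n := n)
    (by simpa using ha) hn
  set m : ℝ := min (1 ^ a) ((3 / 2) ^ a)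
  set M : ℝ := max ((1 / 2) ^ a) ((3 / 2) ^ a)
  have hm : 0 < m := lt_min (by positivity) (by positivity)
  have hM : 0 < M := lt_max_of_lt_left (by positivity)
  refine ⟨max c (M * 4 / (m / (2 * n))), lt_max_of_lt_left hc, fun s R hs hR => ?_⟩
  rcases le_total s (4 * R) with hsR | hsR
  · have hH := H s R hs hR hsR
    simp only [add_zero, Real.rpow_zero, mul_one] at hH
    refine (lintegral_mono_set fun t ht => ?_).trans (hH.trans ?_)
    · exact ⟨ht.2, by have := ht.1.2; linarith⟩
    · gcongr
      exact le_max_left _ _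
  · have hRn : R / n ≤ R := div_le_self hR.le hn
    have hRn' : 0 < R / (2 * n) := by positivity
    have low := ofReal_mul_le_setLIntegral_Ioo (f := fun t => t ^ a) (p := s + R / (2 * n))
      (q := s + R / n) (k := m * s ^ a) (by positivity) fun t ht =>
        min_rpow_mul_le_rpow a one_pos hs (by linarith [ht.1]) (by linarith [ht.2])
    have up := setLIntegral_Ioo_le_ofReal_mul (f := fun t => t ^ a) (p := s - 2 * R)
      (q := s + 2 * R) (k := M * s ^ a) (by positivity) fun t ht =>
        rpow_le_max_rpow_mul a (by norm_num) hs (by linarith [ht.1]) (by linarith [ht.2])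
    calc _ ≤ _ := lintegral_mono_set inter_subset_left
      _ ≤ _ := up
      _ = ENNReal.ofReal (M * 4 / (m / (2 * n))) *
          ENNReal.ofReal (m * s ^ a * (s + R / n - (s + R / (2 * n)))) := by
        rw [← ENNReal.ofReal_mul (by positivity)]
        congr 1
        field_simp
        ring
      _ ≤ _ := by
        gcongr
        exact le_max_right _ _

theorem measurable_ofReal_rpow (b : ℝ) : Measurable fun t : ℝ => ENNReal.ofReal (t ^ b) :=
  (measurable_id.pow_const b).ennreal_ofReal

theorem measurableSet_positive_orthant (d : ℕ) :
    MeasurableSet {x : EuclideanSpace ℝ (Fin d) | ∀ i, 0 < x i} := by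
  simp only [ofPred_forall]
  exact MeasurableSet.iInter fun i => measurableSet_lt measurable_const (by fun_prop)

theorem setLIntegral_lagMeasure {d : ℕ} (α : Fin d → ℝ) {B : Set (EuclideanSpace ℝ (Fin d))}
    (hB : MeasurableSet B) {g : EuclideanSpace ℝ (Fin d) → ENNReal} (hg : Measurable g) :
    ∫⁻ x in B, g x ∂(lagMeasure d α) =
      ∫⁻ x in B ∩ {x | ∀ i, 0 < x i}, (∏ i, ENNReal.ofReal (x i ^ (2 * α i + 1))) * g x := by
  rw [lagMeasure, setLIntegral_withDensity_eq_setLIntegral_mul _ (by fun_prop) hg hB,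
    Measure.restrict_restrict hB]
  refine setLIntegral_congr_fun (hB.inter (measurableSet_positive_orthant d)) fun x hx => ?_
  simp only [Pi.mul_apply]
  rw [ENNReal.ofReal_prod_of_nonneg fun i _ => Real.rpow_nonneg (hx.2 i).le _]

theorem measurable_ofReal_norm_rpow (d : ℕ) (β : ℝ) :
    Measurable fun x : EuclideanSpace ℝ (Fin d) => ENNReal.ofReal (‖x‖ ^ β) :=
  (measurable_norm.pow_const β).ennreal_ofReal

theorem setLIntegral_lagMeasure_le_prod {d : ℕ} (α γ : Fin d → ℝ) {β M : ℝ} (hM : 0 ≤ M)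
    {B : Set (EuclideanSpace ℝ (Fin d))} (hB : MeasurableSet B) {S : Fin d → Set ℝ}
    (hBS : ∀ x ∈ B, (∀ i, 0 < x i) → ∀ i, x i ∈ S i)
    (hβ : ∀ x ∈ B, (∀ i, 0 < x i) → ‖x‖ ^ β ≤ M * ∏ i, x i ^ γ i) :
    ∫⁻ x in B, ENNReal.ofReal (‖x‖ ^ β) ∂(lagMeasure d α) ≤
      ENNReal.ofReal M * ∏ i, ∫⁻ t in S i, ENNReal.ofReal (t ^ (2 * α i + 1 + γ i)) := by
  rw [setLIntegral_lagMeasure α hB (measurable_ofReal_norm_rpow d β),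
    ← setLIntegral_box_prod_eq_prod S fun i => measurable_ofReal_rpow _,
    ← lintegral_const_mul' _ _ ENNReal.ofReal_ne_top]
  refine (setLIntegral_mono' (hB.inter (measurableSet_positive_orthant d)) fun x hx => ?_).trans
    (lintegral_mono_set fun x hx => hBS x hx.1 hx.2)
  have hx0 := hx.2
  rw [← ENNReal.ofReal_prod_of_nonneg fun i _ => Real.rpow_nonneg (hx0 i).le _,
    ← ENNReal.ofReal_prod_of_nonneg fun i _ => Real.rpow_nonneg (hx0 i).le _,
    ← ENNReal.ofReal_mul (Finset.prod_nonneg fun i _ => Real.rpow_nonneg (hx0 i).le _),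
    ← ENNReal.ofReal_mul hM]
  refine ENNReal.ofReal_le_ofReal ?_
  simp_rw [Real.rpow_add (hx0 _) _ (γ _), Finset.prod_mul_distrib]
  calc _ ≤ (∏ i, x i ^ (2 * α i + 1)) * (M * ∏ i, x i ^ γ i) :=
        mul_le_mul_of_nonneg_left (hβ x hx.1 hx0)
          (Finset.prod_nonneg fun i _ => Real.rpow_nonneg (hx0 i).le _)
    _ = _ := by ring

theorem prod_le_setLIntegral_lagMeasure {d : ℕ} (α : Fin d → ℝ) {β m : ℝ}
    {B : Set (EuclideanSpace ℝ (Fin d))} (hB : MeasurableSet B) {T : Fin d → Set ℝ}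
    (hT : ∀ i, MeasurableSet (T i))
    (hTB : ∀ x : EuclideanSpace ℝ (Fin d), (∀ i, x i ∈ T i) →
      x ∈ B ∧ (∀ i, 0 < x i) ∧ m ≤ ‖x‖ ^ β) :
    ENNReal.ofReal m * ∏ i, ∫⁻ t in T i, ENNReal.ofReal (t ^ (2 * α i + 1)) ≤
      ∫⁻ x in B, ENNReal.ofReal (‖x‖ ^ β) ∂(lagMeasure d α) := by
  have hbox : MeasurableSet {x : EuclideanSpace ℝ (Fin d) | ∀ i, x i ∈ T i} := by
    simp only [ofPred_forall]
    exact MeasurableSet.iInter fun i =>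
      (by fun_prop : Measurable fun x : EuclideanSpace ℝ (Fin d) => x i) (hT i)
  rw [setLIntegral_lagMeasure α hB (measurable_ofReal_norm_rpow d β),
    ← setLIntegral_box_prod_eq_prod T fun i => measurable_ofReal_rpow _,
    ← lintegral_const_mul' _ _ ENNReal.ofReal_ne_top]
  refine (setLIntegral_mono' hbox fun x hx => ?_).trans
    (lintegral_mono_set fun x hx => ⟨(hTB x hx).1, (hTB x hx).2.1⟩)
  rw [mul_comm]
  gcongr
  exact (hTB x hx).2.2

theorem ofReal_mul_prod_le {d : ℕ} {U L : Fin d → ENNReal} {e : Fin d → ℝ} {M m C : ℝ}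
    (he : ∀ i, 0 ≤ e i) (hM : 0 ≤ M) (hC : 0 ≤ C)
    (hUL : ∀ i, U i ≤ ENNReal.ofReal (e i) * L i) (h : M * ∏ i, e i ≤ C * m) :
    ENNReal.ofReal M * ∏ i, U i ≤ ENNReal.ofReal C * (ENNReal.ofReal m * ∏ i, L i) := by
  calc ENNReal.ofReal M * ∏ i, U i
      ≤ ENNReal.ofReal M * ∏ i, (ENNReal.ofReal (e i) * L i) := by
        gcongr with i
        exact hUL i
    _ = ENNReal.ofReal (M * ∏ i, e i) * ∏ i, L i := by
        rw [Finset.prod_mul_distrib, ← ENNReal.ofReal_prod_of_nonneg fun i _ => he i, ← mul_assoc,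
          ← ENNReal.ofReal_mul hM]
    _ ≤ ENNReal.ofReal (C * m) * ∏ i, L i := by gcongr
    _ = _ := by rw [ENNReal.ofReal_mul hC, mul_assoc]

theorem EuclideanSpace.norm_le_sum_norm {d : ℕ} (x : EuclideanSpace ℝ (Fin d)) :
    ‖x‖ ≤ ∑ i, ‖x i‖ := by
  rw [EuclideanSpace.norm_eq]
  exact Real.sqrt_le_iff.2 ⟨Finset.sum_nonneg fun i _ => norm_nonneg _,
    Finset.sum_sq_le_sq_sum_of_nonneg fun i _ => norm_nonneg _⟩

theorem mem_ball_of_forall_mem_Ioo {d : ℕ} (hd : 0 < d) {x x₀ : EuclideanSpace ℝ (Fin d)} {R : ℝ}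
    (hR : 0 < R) (h : ∀ i, x i ∈ Ioo (x₀ i + R / (2 * d)) (x₀ i + R / d)) :
    x ∈ Metric.ball x₀ R := by
  have hd' : (0 : ℝ) < d := by exact_mod_cast hd
  have : Nonempty (Fin d) := ⟨⟨0, hd⟩⟩
  have hRd : 0 < R / (2 * d) := by positivity
  rw [mem_ball_iff_norm]
  calc ‖x - x₀‖ ≤ ∑ i, ‖(x - x₀) i‖ := EuclideanSpace.norm_le_sum_norm _
    _ < ∑ _i : Fin d, R / d := by
      refine Finset.sum_lt_sum_of_nonempty Finset.univ_nonempty fun i _ => ?_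
      have := h i
      rw [PiLp.sub_apply, Real.norm_eq_abs, abs_lt]
      constructor <;> linarith [this.1, this.2]
    _ = R := by
      simp
      field_simp

/-- Near the origin, `‖x‖ ^ β` is dominated by a product of one-dimensional powers whose exponents
keep each coordinate weight integrable. -/
theorem exists_norm_rpow_le_prod {d : ℕ} (hd : 0 < d) {α : Fin d → ℝ} (hα : ∀ i, -1 < α i)
    {β : ℝ} (hβ : -2 * ((∑ i, α i) + d) < β) :
    ∃ (γ : Fin d → ℝ) (M : ℝ), 0 < M ∧ (∀ i, -1 < 2 * α i + 1 + γ i) ∧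
      ∀ R : ℝ, 0 < R → ∀ x : EuclideanSpace ℝ (Fin d), (∀ i, 0 < x i) → ‖x‖ ≤ 6 * R →
        ‖x‖ ^ β ≤ M * R ^ (β - ∑ i, γ i) * ∏ i, x i ^ γ i := by
  rcases le_total 0 β with hβ0 | hβ0
  · refine ⟨0, 6 ^ β, by positivity, fun i => ?_, fun R hR x hx hxR => ?_⟩
    · have := hα i
      simp only [Pi.zero_apply]
      linarith
    · simp only [Pi.zero_apply, Finset.sum_const_zero, sub_zero, Real.rpow_zero,
        Finset.prod_const_one, mul_one]
      rw [← Real.mul_rpow (by norm_num) hR.le]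
      exact Real.rpow_le_rpow (norm_nonneg _) hxR hβ0
  · have : Nonempty (Fin d) := ⟨⟨0, hd⟩⟩
    set Q : ℝ := ∑ i, (2 * α i + 2) with hQ_def
    have hQ : 0 < Q := Finset.sum_pos (fun i _ => by linarith [hα i]) Finset.univ_nonempty
    have hQ_eq : Q = 2 * ((∑ i, α i) + d) := by
      rw [hQ_def, Finset.sum_add_distrib, ← Finset.mul_sum]
      simp
      ring
    have hsum : ∑ i, β * ((2 * α i + 2) / Q) = β := by
      rw [← Finset.mul_sum, ← Finset.sum_div, div_self hQ.ne', mul_one]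
    refine ⟨fun i => β * ((2 * α i + 2) / Q), 1, one_pos, fun i => ?_, fun R hR x hx _ => ?_⟩
    · have h1 : 0 < 2 * α i + 2 := by linarith [hα i]
      have h2 : 0 < (2 * α i + 2) * ((Q + β) / Q) :=
        mul_pos h1 (div_pos (by linarith) hQ)
      have h3 : (2 * α i + 2) * ((Q + β) / Q) = 2 * α i + 2 + β * ((2 * α i + 2) / Q) := by
        field_simp
      linarith
    · have hle : ∀ i, x i ≤ ‖x‖ := fun i => (le_abs_self _).trans (PiLp.norm_apply_le x i)
      have hx0 : 0 < ‖x‖ := (hx ⟨0, hd⟩).trans_le (hle _)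
      rw [hsum, sub_self, Real.rpow_zero, one_mul, one_mul]
      calc ‖x‖ ^ β = ∏ i, ‖x‖ ^ (β * ((2 * α i + 2) / Q)) := by
            rw [← Real.rpow_sum_of_pos hx0, hsum]
        _ ≤ _ := by
          refine Finset.prod_le_prod (fun i _ => by positivity) fun i _ => ?_
          refine Real.rpow_le_rpow_of_nonpos (hx i) (hle i) ?_
          exact mul_nonpos_of_nonpos_of_nonneg hβ0
            (div_nonneg (by linarith [hα i]) hQ.le)

/-- Doubling for balls that are large compared to the distance of their centre to the origin. -/
theorem power_weight_doubling_of_norm_le {d : ℕ} (hd : 0 < d) {α : Fin d → ℝ}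
    (hα : ∀ i, -1 < α i) {β : ℝ} (hβ : -2 * ((∑ i, α i) + d) < β) :
    ∃ C : ℝ, 0 < C ∧ ∀ x₀ : EuclideanSpace ℝ (Fin d), (∀ i, 0 < x₀ i) →
      ∀ R : ℝ, 0 < R → ‖x₀‖ ≤ 4 * R →
        (∫⁻ x in Metric.ball x₀ (2 * R), ENNReal.ofReal (‖x‖ ^ β) ∂(lagMeasure d α)) ≤
          ENNReal.ofReal C *
            ∫⁻ x in Metric.ball x₀ R, ENNReal.ofReal (‖x‖ ^ β) ∂(lagMeasure d α) := by
  have hd1 : (1 : ℝ) ≤ d := by exact_mod_cast hd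
  have hd' : (0 : ℝ) < d := by linarith
  obtain ⟨γ, M, hM, hγ, hbound⟩ := exists_norm_rpow_le_prod hd hα hβ
  choose c hc hcle using fun i => exists_setLIntegral_Ioo_zero_rpow_le (hγ i) hd1
  set m : ℝ := min ((1 / (2 * d)) ^ β) (5 ^ β)
  have hm : 0 < m := lt_min (by positivity) (by positivity)
  have hcp : 0 < ∏ i, c i := Finset.prod_pos fun i _ => hc i
  refine ⟨M * (∏ i, c i) / m, by positivity, fun x₀ hx₀ R hR hxR => ?_⟩
  have hle : ∀ (x : EuclideanSpace ℝ (Fin d)) i, x i ≤ ‖x‖ :=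
    fun x i => (le_abs_self _).trans (PiLp.norm_apply_le x i)
  have hRd : 0 < R / (2 * d) := by positivity
  have hnorm : ∀ x ∈ Metric.ball x₀ (2 * R), ‖x‖ < 6 * R := fun x hx => by
    have h1 := norm_le_norm_add_norm_sub' x x₀
    have h2 := mem_ball_iff_norm.1 hx
    linarith
  have upper := setLIntegral_lagMeasure_le_prod (β := β) (M := M * R ^ (β - ∑ i, γ i)) α γ
    (by positivity) (measurableSet_ball (x := x₀) (ε := 2 * R))
    (S := fun _ => Ioo 0 (6 * R))
    (fun x hx hx0 i => ⟨hx0 i, (hle x i).trans_lt (hnorm x hx)⟩)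
    (fun x hx hx0 => hbound R hR x hx0 (hnorm x hx).le)
  have lower := prod_le_setLIntegral_lagMeasure (β := β) (m := m * R ^ β) α
    (measurableSet_ball (x := x₀) (ε := R))
    (T := fun i => Ioo (x₀ i + R / (2 * d)) (x₀ i + R / d)) (fun _ => measurableSet_Ioo)
    (fun x hx => by
      have hxb := mem_ball_of_forall_mem_Ioo hd hR hx
      refine ⟨hxb, fun i => by linarith [(hx i).1, hx₀ i],
        min_rpow_mul_le_rpow β (by positivity) hR ?_ ?_⟩
      · rw [one_div_mul_eq_div]
        linarith [hle x ⟨0, hd⟩, (hx ⟨0, hd⟩).1, hx₀ ⟨0, hd⟩]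
      · have h1 := norm_le_norm_add_norm_sub' x x₀
        have h2 := mem_ball_iff_norm.1 hxb
        linarith)
  refine upper.trans (le_trans ?_ (mul_le_mul_right lower _))
  refine ofReal_mul_prod_le (e := fun i => c i * R ^ γ i)
    (fun i => mul_nonneg (hc i).le (by positivity)) (by positivity) (by positivity)
    (fun i => hcle i (x₀ i) R (hx₀ i) hR ((hle x₀ i).trans hxR)) (le_of_eq ?_)
  rw [Finset.prod_mul_distrib, ← Real.rpow_sum_of_pos hR, Real.rpow_sub hR]
  field_simp

/-- Doubling for balls that are small compared to the distance of their centre to the origin. -/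
theorem power_weight_doubling_of_le_norm {d : ℕ} (hd : 0 < d) {α : Fin d → ℝ}
    (hα : ∀ i, -1 < α i) (β : ℝ) :
    ∃ C : ℝ, 0 < C ∧ ∀ x₀ : EuclideanSpace ℝ (Fin d), (∀ i, 0 < x₀ i) →
      ∀ R : ℝ, 0 < R → 4 * R ≤ ‖x₀‖ →
        (∫⁻ x in Metric.ball x₀ (2 * R), ENNReal.ofReal (‖x‖ ^ β) ∂(lagMeasure d α)) ≤
          ENNReal.ofReal C *
            ∫⁻ x in Metric.ball x₀ R, ENNReal.ofReal (‖x‖ ^ β) ∂(lagMeasure d α) := by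
  have hd1 : (1 : ℝ) ≤ d := by exact_mod_cast hd
  have hd' : (0 : ℝ) < d := by linarith
  choose c hc hcle using fun i =>
    exists_setLIntegral_Ioo_inter_Ioi_rpow_le (a := 2 * α i + 1) (by linarith [hα i]) hd1
  set m : ℝ := min ((1 / 2) ^ β) ((3 / 2) ^ β)
  set M : ℝ := max ((1 / 2) ^ β) ((3 / 2) ^ β)
  have hm : 0 < m := lt_min (by positivity) (by positivity)
  have hM : 0 < M := lt_max_of_lt_left (by positivity)
  have hcp : 0 < ∏ i, c i := Finset.prod_pos fun i _ => hc i
  refine ⟨M * (∏ i, c i) / m, by positivity, fun x₀ hx₀ R hR hxR => ?_⟩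
  have hx₀n : 0 < ‖x₀‖ := by linarith
  have hRd : 0 < R / (2 * d) := by positivity
  have hnorm : ∀ x ∈ Metric.ball x₀ (2 * R), 1 / 2 * ‖x₀‖ ≤ ‖x‖ ∧ ‖x‖ ≤ 3 / 2 * ‖x₀‖ :=
    fun x hx => by
      have h1 := norm_le_norm_add_norm_sub' x x₀
      have h2 := mem_ball_iff_norm.1 hx
      have h3 := norm_le_norm_add_norm_sub x x₀
      constructor <;> linarith
  have upper := setLIntegral_lagMeasure_le_prod (β := β) (M := M * ‖x₀‖ ^ β) α 0
    (by positivity) (measurableSet_ball (x := x₀) (ε := 2 * R))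
    (S := fun i => Ioo (x₀ i - 2 * R) (x₀ i + 2 * R) ∩ Ioi 0)
    (fun x hx hx0 i => by
      have h1 := PiLp.norm_apply_le (x - x₀) i
      have h2 := mem_ball_iff_norm.1 hx
      rw [PiLp.sub_apply, Real.norm_eq_abs] at h1
      have h3 := abs_lt.1 (h1.trans_lt h2)
      exact ⟨⟨by linarith [h3.1], by linarith [h3.2]⟩, hx0 i⟩)
    (fun x hx hx0 => by
      simp only [Pi.zero_apply, Real.rpow_zero, Finset.prod_const_one, mul_one]
      exact rpow_le_max_rpow_mul β (by norm_num) hx₀n (hnorm x hx).1 (hnorm x hx).2)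
  have lower := prod_le_setLIntegral_lagMeasure (β := β) (m := m * ‖x₀‖ ^ β) α
    (measurableSet_ball (x := x₀) (ε := R))
    (T := fun i => Ioo (x₀ i + R / (2 * d)) (x₀ i + R / d)) (fun _ => measurableSet_Ioo)
    (fun x hx => by
      have hxb := mem_ball_of_forall_mem_Ioo hd hR hx
      have hx2 := hnorm x (Metric.ball_subset_ball (by linarith) hxb)
      exact ⟨hxb, fun i => by linarith [(hx i).1, hx₀ i],
        min_rpow_mul_le_rpow β (by norm_num) hx₀n hx2.1 hx2.2⟩)
  simp only [Pi.zero_apply, add_zero] at upper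
  refine upper.trans (le_trans ?_ (mul_le_mul_right lower _))
  refine ofReal_mul_prod_le (e := c) (fun i => (hc i).le) (by positivity) (by positivity)
    (fun i => hcle i (x₀ i) R (hx₀ i) hR) (le_of_eq ?_)
  field_simp

/-- The measure |x|^β dμ_α(x) is doubling on (0,∞)^d when β > -2(|α|₁+d). -/
theorem power_weight_doubling (d : ℕ) (hd : 0 < d) (α : Fin d → ℝ) (hα : ∀ i, -1 < α i)
    (β : ℝ) (hβ : -2 * ((∑ i, α i) + d) < β) :
    ∃ C : ℝ, 0 < C ∧ ∀ x₀ : EuclideanSpace ℝ (Fin d), (∀ i, 0 < x₀ i) →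
      ∀ R : ℝ, 0 < R →
        (∫⁻ x in Metric.ball x₀ (2 * R), ENNReal.ofReal (‖x‖ ^ β) ∂(lagMeasure d α)) ≤
          ENNReal.ofReal C *
            ∫⁻ x in Metric.ball x₀ R, ENNReal.ofReal (‖x‖ ^ β) ∂(lagMeasure d α) := by
  obtain ⟨C₁, hC₁, h₁⟩ := power_weight_doubling_of_norm_le hd hα hβ
  obtain ⟨C₂, hC₂, h₂⟩ := power_weight_doubling_of_le_norm hd hα β
  refine ⟨max C₁ C₂, lt_max_of_lt_left hC₁, fun x₀ hx₀ R hR => ?_⟩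
  rcases le_total ‖x₀‖ (4 * R) with h | h
  · refine (h₁ x₀ hx₀ R hR h).trans ?_
    gcongr
    exact le_max_left _ _
  · refine (h₂ x₀ hx₀ R hR h).trans ?_
    gcongr
    exact le_max_right _ _
end

section
/- Let α > -1 and β ≥ 0. There exists C > 0 such that for all sufficiently large n, ∫_0^∞ (φ_n^α(x))² (1+x)^β x^{2α+1} dx ≥ C n^{β/2}, and ∫_0^∞ (φ_n^α(x))² (1+x)^{-β} x^{2α+1} dx ≥ C max{n^{-β/2}, n^{-1/2}}. -/
noncomputable def laguerre (a : ℝ) (n : ℕ) (x : ℝ) : ℝ :=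
  ∑ j ∈ Finset.range (n + 1),
    Real.Gamma (n + a + 1) / (Real.Gamma (((n - j : ℕ) : ℝ) + 1) * Real.Gamma (j + a + 1)) *
      (-x) ^ j / (Nat.factorial j)

/-- The one-dimensional Laguerre function φ_n^a(x), orthonormal in L²((0,∞), x^{2a+1}dx). -/
noncomputable def laguerreFun (a : ℝ) (n : ℕ) (x : ℝ) : ℝ :=
  Real.sqrt (2 * Nat.factorial n / Real.Gamma (n + a + 1)) * laguerre a n (x ^ 2) *
    Real.exp (-x ^ 2 / 2)

section LaguerrePolynomials

open Polynomial

/-- The linear functional `p ↦ ∫₀^∞ p(t) t^a e^{-t} dt` on polynomials. -/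
noncomputable def gammaFunctional (a : ℝ) : ℝ[X] →ₗ[ℝ] ℝ :=
  Polynomial.lsum fun j => LinearMap.mulRight ℝ (Real.Gamma (j + a + 1))

/-- The Laguerre polynomial of type `a`, divided by `Γ(n+a+1)/n!`. -/
noncomputable def normalizedLaguerre (a : ℝ) (n : ℕ) : ℝ[X] :=
  ∑ j ∈ Finset.range (n + 1), monomial j ((-1) ^ j * (n.choose j : ℝ) / Real.Gamma (j + a + 1))

/-- The squared norm of the `n`-th Laguerre polynomial, `Γ(n+a+1)/n!`. -/
noncomputable def laguerreNormSq (a : ℝ) (n : ℕ) : ℝ :=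
  Real.Gamma (n + a + 1) / (Nat.factorial n : ℝ)

section Algebra

variable {a : ℝ}

lemma gammaFunctional_monomial (j : ℕ) (c : ℝ) :
    gammaFunctional a (monomial j c) = c * Real.Gamma (j + a + 1) := by
  simp [gammaFunctional, Polynomial.lsum_apply, Polynomial.sum_monomial_index]

lemma Gamma_natCast_add_pos (ha : -1 < a) (j : ℕ) : 0 < Real.Gamma (j + a + 1) :=
  Real.Gamma_pos_of_pos (by linarith [(Nat.cast_nonneg j : (0 : ℝ) ≤ j)])

lemma laguerreNormSq_pos (ha : -1 < a) (n : ℕ) : 0 < laguerreNormSq a n :=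
  div_pos (Gamma_natCast_add_pos ha n) (by positivity)

lemma Gamma_natCast_succ (ha : -1 < a) (n : ℕ) :
    Real.Gamma ((n + 1 : ℕ) + a + 1) = (n + a + 1) * Real.Gamma (n + a + 1) := by
  have h : (n : ℝ) + a + 1 ≠ 0 := by linarith [(Nat.cast_nonneg n : (0 : ℝ) ≤ n)]
  rw [← Real.Gamma_add_one h]
  push_cast
  ring_nf

lemma succ_mul_laguerreNormSq_succ (ha : -1 < a) (n : ℕ) :
    (n + 1) * laguerreNormSq a (n + 1) = (n + a + 1) * laguerreNormSq a n := by
  have h : ((n : ℝ) + 1) ≠ 0 := by positivity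
  have h' : (Nat.factorial n : ℝ) ≠ 0 := by positivity
  rw [laguerreNormSq, laguerreNormSq, Gamma_natCast_succ ha, Nat.factorial_succ]
  push_cast
  field_simp

lemma mul_laguerreNormSq_monotone (ha : -1 < a) :
    Monotone fun n : ℕ => (n : ℝ) * laguerreNormSq a n := by
  refine monotone_nat_of_le_succ fun n => ?_
  have h := succ_mul_laguerreNormSq_succ ha n
  push_cast
  rw [h]
  exact mul_le_mul_of_nonneg_right (by linarith) (laguerreNormSq_pos ha n).le

lemma coeff_normalizedLaguerre (n j : ℕ) :
    (normalizedLaguerre a n).coeff j = (-1) ^ j * (n.choose j : ℝ) / Real.Gamma (j + a + 1) := by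
  rw [normalizedLaguerre, finsetSum_coeff]
  simp only [coeff_monomial, Finset.sum_ite_eq', Finset.mem_range]
  split_ifs with h
  · rfl
  · rw [Nat.choose_eq_zero_of_lt (by lia)]; simp

lemma natDegree_normalizedLaguerre_le (n : ℕ) : (normalizedLaguerre a n).natDegree ≤ n := by
  rw [natDegree_le_iff_coeff_eq_zero]
  intro j hj
  rw [coeff_normalizedLaguerre, Nat.choose_eq_zero_of_lt hj]
  simp

lemma ascPochhammer_eval_mul_Gamma (ha : -1 < a) (m j : ℕ) :
    (ascPochhammer ℝ m).eval ((j : ℝ) + a + 1) * Real.Gamma (j + a + 1) =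
      Real.Gamma ((j + m : ℕ) + a + 1) := by
  induction m with
  | zero => simp
  | succ m ih =>
    rw [ascPochhammer_succ_eval, mul_right_comm, ih, ← add_assoc, Gamma_natCast_succ ha]
    push_cast
    ring

lemma gammaFunctional_X_pow_mul_normalizedLaguerre (ha : -1 < a) (m n : ℕ) :
    gammaFunctional a (X ^ m * normalizedLaguerre a n) =
      ∑ j ∈ Finset.range (n + 1), (-1) ^ j * (n.choose j : ℝ) *
        ((ascPochhammer ℝ m).comp (X + C (a + 1))).eval (j : ℝ) := by
  rw [normalizedLaguerre, Finset.mul_sum, map_sum]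
  refine Finset.sum_congr rfl fun j _ => ?_
  have h := (Gamma_natCast_add_pos ha j).ne'
  rw [X_pow_mul_monomial, gammaFunctional_monomial, ← ascPochhammer_eval_mul_Gamma ha]
  simp only [eval_comp, eval_add, eval_X, eval_C, ← add_assoc]
  field_simp

lemma sum_neg_one_pow_choose_eval (P : ℝ[X]) (n : ℕ) :
    ∑ j ∈ Finset.range (n + 1), (-1) ^ j * (n.choose j : ℝ) * P.eval (j : ℝ) =
      (-1) ^ n * (fwdDiff (1 : ℝ))^[n] (fun x => P.eval x) 0 := by
  rw [fwdDiff_iter_eq_sum_shift, Finset.mul_sum]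
  refine Finset.sum_congr rfl fun j hj => ?_
  have hj : j ≤ n := by simpa [Nat.lt_succ_iff] using hj
  obtain ⟨d, rfl⟩ := Nat.exists_eq_add_of_le hj
  have h : ((-1 : ℝ) ^ d) * (-1) ^ d = 1 := by rw [← mul_pow]; simp
  simp only [add_tsub_cancel_left, zsmul_eq_mul, zero_add, nsmul_eq_mul, mul_one, pow_add]
  push_cast
  linear_combination (-1 : ℝ) ^ j * ((j + d).choose j : ℝ) * P.eval (j : ℝ) * (-h)

lemma natDegree_ascPochhammer_comp (m : ℕ) :
    ((ascPochhammer ℝ m).comp (X + C (a + 1))).natDegree = m := by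
  rw [natDegree_comp, ascPochhammer_natDegree, natDegree_X_add_C, mul_one]

lemma gammaFunctional_X_pow_mul_eq_zero (ha : -1 < a) {m n : ℕ} (h : m < n) :
    gammaFunctional a (X ^ m * normalizedLaguerre a n) = 0 := by
  rw [gammaFunctional_X_pow_mul_normalizedLaguerre ha, sum_neg_one_pow_choose_eval]
  have := Polynomial.fwdDiff_iter_eq_zero_of_degree_lt
    (P := (ascPochhammer ℝ m).comp (X + C (a + 1))) (n := n)
    (by rwa [natDegree_ascPochhammer_comp])
  rw [this]
  simp

lemma gammaFunctional_X_pow_mul_self (ha : -1 < a) (n : ℕ) :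
    gammaFunctional a (X ^ n * normalizedLaguerre a n) = (-1) ^ n * (Nat.factorial n : ℝ) := by
  rw [gammaFunctional_X_pow_mul_normalizedLaguerre ha, sum_neg_one_pow_choose_eval]
  have := Polynomial.fwdDiff_iter_degree_eq_factorial
    ((ascPochhammer ℝ n).comp (X + C (a + 1)))
  rw [natDegree_ascPochhammer_comp,
    ((monic_ascPochhammer ℝ n).comp_X_add_C (a + 1)).leadingCoeff] at this
  rw [this]
  simp

lemma gammaFunctional_mul_normalizedLaguerre (ha : -1 < a) {p : ℝ[X]} {n : ℕ}
    (hp : p.natDegree ≤ n) :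
    gammaFunctional a (p * normalizedLaguerre a n) =
      p.coeff n * ((-1) ^ n * (Nat.factorial n : ℝ)) := by
  conv_lhs => rw [p.as_sum_range_C_mul_X_pow' (Nat.lt_succ_of_le hp)]
  rw [Finset.sum_mul, map_sum, Finset.sum_range_succ, Finset.sum_eq_zero, zero_add]
  · rw [mul_assoc, ← smul_eq_C_mul, map_smul, gammaFunctional_X_pow_mul_self ha, smul_eq_mul]
  · intro j hj
    rw [mul_assoc, ← smul_eq_C_mul, map_smul,
      gammaFunctional_X_pow_mul_eq_zero ha (Finset.mem_range.1 hj), smul_zero]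

lemma gammaFunctional_mul_of_lt (ha : -1 < a) {m n : ℕ} (h : m < n) :
    gammaFunctional a (normalizedLaguerre a m * normalizedLaguerre a n) = 0 := by
  rw [gammaFunctional_mul_normalizedLaguerre ha
    ((natDegree_normalizedLaguerre_le m).trans h.le), coeff_normalizedLaguerre,
    Nat.choose_eq_zero_of_lt h]
  simp

lemma gammaFunctional_mul_of_ne (ha : -1 < a) {m n : ℕ} (h : m ≠ n) :
    gammaFunctional a (normalizedLaguerre a m * normalizedLaguerre a n) = 0 := by
  rcases lt_or_gt_of_ne h with h | h
  · exact gammaFunctional_mul_of_lt ha h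
  · rw [mul_comm]; exact gammaFunctional_mul_of_lt ha h

lemma gammaFunctional_mul_self (ha : -1 < a) (n : ℕ) :
    gammaFunctional a (normalizedLaguerre a n * normalizedLaguerre a n) =
      (laguerreNormSq a n)⁻¹ := by
  have h : ((-1 : ℝ) ^ n) * (-1) ^ n = 1 := by rw [← mul_pow]; simp
  rw [gammaFunctional_mul_normalizedLaguerre ha (natDegree_normalizedLaguerre_le n),
    coeff_normalizedLaguerre, laguerreNormSq, inv_div, Nat.choose_self, Nat.cast_one]
  linear_combination (Nat.factorial n : ℝ) / Real.Gamma (n + a + 1) * h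

/-- Three-term recurrence. -/
lemma X_mul_normalizedLaguerre (ha : -1 < a) (n : ℕ) :
    X * normalizedLaguerre a (n + 1) = (2 * (n + 1 : ℝ) + a + 1) • normalizedLaguerre a (n + 1)
      - (n + 1 + a + 1 : ℝ) • normalizedLaguerre a (n + 2)
      - (n + 1 : ℝ) • normalizedLaguerre a n := by
  ext j
  rcases j with _ | j
  · simp [coeff_normalizedLaguerre]
    ring
  · have h := (Gamma_natCast_add_pos ha j).ne'
    have h0 : (j : ℝ) + a + 1 ≠ 0 := by linarith [(Nat.cast_nonneg j : (0 : ℝ) ≤ j)]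
    rw [coeff_X_mul]
    simp only [coeff_sub, coeff_smul, coeff_normalizedLaguerre, smul_eq_mul]
    rw [Gamma_natCast_succ ha]
    have h1 : ((n + 2).choose (j + 1) : ℝ) = (n + 1).choose j + (n + 1).choose (j + 1) := by
      exact_mod_cast Nat.choose_succ_succ (n + 1) j
    have h2 : ((n + 1).choose (j + 1) : ℝ) = n.choose j + n.choose (j + 1) := by
      exact_mod_cast Nat.choose_succ_succ n j
    have h3 : ((n + 1).choose (j + 1) : ℝ) * (j + 1) = (n + 1) * n.choose j := by
      exact_mod_cast (Nat.add_one_mul_choose_eq n j).symm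
    have h4 : ((n + 1).choose (j + 1) : ℝ) * (j + 1) = (n + 1).choose j * (n + 1 - j) := by
      rcases le_or_gt j (n + 1) with hj | hj
      · have := Nat.choose_succ_right_eq (n + 1) j
        rw [← Nat.cast_inj (R := ℝ)] at this
        push_cast [Nat.cast_sub hj] at this
        exact this
      · rw [Nat.choose_eq_zero_of_lt hj, Nat.choose_eq_zero_of_lt (by lia : n + 1 < j + 1)]
        simp
    rw [h1, pow_succ]
    field_simp
    linear_combination ((n : ℝ) + 1) * h2 - h3 + h4

lemma gammaFunctional_X_mul_sq (ha : -1 < a) (n : ℕ) :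
    gammaFunctional a (X * normalizedLaguerre a (n + 1) * normalizedLaguerre a (n + 1)) =
      (2 * (n + 1 : ℝ) + a + 1) * (laguerreNormSq a (n + 1))⁻¹ := by
  rw [X_mul_normalizedLaguerre ha]
  simp only [sub_mul, smul_mul_assoc, map_sub, map_smul, gammaFunctional_mul_self ha,
    gammaFunctional_mul_of_ne ha (show n + 2 ≠ n + 1 by lia),
    gammaFunctional_mul_of_ne ha (show n ≠ n + 1 by lia), smul_eq_mul]
  ring

lemma gammaFunctional_X_mul_mul_X_mul (ha : -1 < a) (n : ℕ) :
    gammaFunctional a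
        ((X * normalizedLaguerre a (n + 1)) * (X * normalizedLaguerre a (n + 1))) =
      ((2 * (n + 1 : ℝ) + a + 1) ^ 2 + (n + 2) * (n + a + 2) + (n + 1) * (n + 1 + a)) *
        (laguerreNormSq a (n + 1))⁻¹ := by
  rw [X_mul_normalizedLaguerre ha]
  simp only [sub_mul, mul_sub, smul_mul_assoc, mul_smul_comm, map_sub, map_smul,
    gammaFunctional_mul_self ha,
    gammaFunctional_mul_of_ne ha (show n + 2 ≠ n + 1 by lia),
    gammaFunctional_mul_of_ne ha (show n + 1 ≠ n + 2 by lia),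
    gammaFunctional_mul_of_ne ha (show n ≠ n + 1 by lia),
    gammaFunctional_mul_of_ne ha (show n + 1 ≠ n by lia),
    gammaFunctional_mul_of_ne ha (show n + 2 ≠ n by lia),
    gammaFunctional_mul_of_ne ha (show n ≠ n + 2 by lia), smul_eq_mul]
  have h1 := succ_mul_laguerreNormSq_succ ha n
  have h2 := succ_mul_laguerreNormSq_succ ha (n + 1)
  have p0 := (laguerreNormSq_pos ha n).ne'
  have p1 := (laguerreNormSq_pos ha (n + 1)).ne'
  have p2 := (laguerreNormSq_pos ha (n + 2)).ne'
  push_cast at h2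
  have e1 : ((n : ℝ) + 1) * (laguerreNormSq a n)⁻¹ =
      (n + a + 1) * (laguerreNormSq a (n + 1))⁻¹ := by
    field_simp; linear_combination h1
  have e2 : ((n : ℝ) + 1 + a + 1) * (laguerreNormSq a (n + 2))⁻¹ =
      (n + 2) * (laguerreNormSq a (n + 1))⁻¹ := by
    field_simp; linear_combination -h2
  linear_combination ((n : ℝ) + 1) * e1 + ((n : ℝ) + 1 + a + 1) * e2

/-- Multiplication theorem for the argument `t / 2`. -/
lemma normalizedLaguerre_comp_half (n : ℕ) :
    (normalizedLaguerre a n).comp (C (1 / 2) * X) =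
      ∑ k ∈ Finset.range (n + 1), ((1 / 2 : ℝ) ^ n * n.choose k) • normalizedLaguerre a k := by
  ext j
  rw [comp_C_mul_X_coeff, finsetSum_coeff]
  simp only [coeff_smul, coeff_normalizedLaguerre, smul_eq_mul]
  have key : (∑ k ∈ Finset.range (n + 1), (n.choose k : ℝ) * (k.choose j : ℝ)) * (1 / 2) ^ n =
      n.choose j * (1 / 2) ^ j := by
    rcases le_or_gt j n with hj | hj
    · obtain ⟨d, rfl⟩ := Nat.exists_eq_add_of_le hj
      have : ∑ k ∈ Finset.range (j + d + 1), (j + d).choose k * k.choose j =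
          (j + d).choose j * 2 ^ d := by
        rw [add_assoc, Finset.sum_range_add, Finset.sum_eq_zero, zero_add,
          ← Nat.sum_range_choose, Finset.mul_sum]
        · refine Finset.sum_congr rfl fun i hi => ?_
          have hi : i ≤ d := by simpa [Nat.lt_succ_iff] using hi
          rw [Nat.choose_mul (Nat.le_add_right j i)]
          simp
        · intro k hk
          rw [Nat.choose_eq_zero_of_lt (Finset.mem_range.1 hk), mul_zero]
      rw [← Nat.cast_inj (R := ℝ)] at this
      push_cast at this
      rw [this, pow_add, one_div, inv_pow, inv_pow]
      field_simp
    · rw [Nat.choose_eq_zero_of_lt hj, Finset.sum_eq_zero]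
      · simp
      · intro k hk
        rw [Nat.choose_eq_zero_of_lt (show k < j by have := Finset.mem_range.1 hk; lia)]
        simp
  calc _ = (-1) ^ j / Real.Gamma (j + a + 1) * (n.choose j * (1 / 2) ^ j) := by ring
    _ = _ := by
      rw [← key, Finset.sum_mul, Finset.mul_sum]
      refine Finset.sum_congr rfl fun k _ => ?_
      ring

lemma gammaFunctional_comp_half_sq (ha : -1 < a) (n : ℕ) :
    gammaFunctional a ((normalizedLaguerre a n * normalizedLaguerre a n).comp (C (1 / 2) * X)) =
      (1 / 4) ^ n * ∑ k ∈ Finset.range (n + 1),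
        (n.choose k : ℝ) ^ 2 * (laguerreNormSq a k)⁻¹ := by
  rw [mul_comp, normalizedLaguerre_comp_half, Finset.sum_mul, map_sum, Finset.mul_sum]
  refine Finset.sum_congr rfl fun k hk => ?_
  rw [Finset.mul_sum, map_sum, Finset.sum_eq_single_of_mem k hk]
  · rw [smul_mul_smul_comm, map_smul, gammaFunctional_mul_self ha, smul_eq_mul,
      show (1 / 4 : ℝ) = 1 / 2 * (1 / 2) by norm_num, mul_pow]
    ring
  · intro l _ hl
    rw [smul_mul_smul_comm, map_smul, gammaFunctional_mul_of_ne ha hl.symm, smul_zero]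

lemma two_mul_sum_mul_choose_sq (n : ℕ) :
    2 * ∑ k ∈ Finset.range (n + 1), (k : ℝ) * (n.choose k : ℝ) ^ 2 = n * n.centralBinom := by
  have h : ∑ k ∈ Finset.range (n + 1), (k : ℝ) * (n.choose k : ℝ) ^ 2 =
      ∑ k ∈ Finset.range (n + 1), ((n : ℝ) - k) * (n.choose k : ℝ) ^ 2 := by
    rw [← Finset.sum_range_reflect]
    refine Finset.sum_congr rfl fun k hk => ?_
    have hk : k ≤ n := by simpa [Nat.lt_succ_iff] using hk
    rw [show n + 1 - 1 - k = n - k by lia, Nat.choose_symm hk, Nat.cast_sub hk]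
  have h' : ∑ k ∈ Finset.range (n + 1), (n.choose k : ℝ) ^ 2 = n.centralBinom := by
    rw [Nat.centralBinom_eq_two_mul_choose, ← Nat.sum_range_choose_sq]
    push_cast
    rfl
  rw [two_mul]
  nth_rw 1 [h]
  rw [← Finset.sum_add_distrib, ← h', Finset.mul_sum]
  exact Finset.sum_congr rfl fun k _ => by ring

lemma sixteen_pow_le_mul_centralBinom_sq (n : ℕ) :
    (16 : ℝ) ^ (n + 1) ≤ 4 * (n + 1) * ((n + 1).centralBinom : ℝ) ^ 2 := by
  induction n with
  | zero => norm_num [Nat.centralBinom, Nat.choose]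
  | succ n ih =>
    have h : ((n : ℝ) + 1 + 1) * ((n + 1 + 1).centralBinom : ℝ) =
        2 * (2 * (n + 1) + 1) * (n + 1).centralBinom := by
      exact_mod_cast Nat.succ_mul_centralBinom_succ (n + 1)
    have hn : (0 : ℝ) < n + 1 + 1 := by positivity
    set y : ℝ := ((n + 1 + 1).centralBinom : ℝ)
    set x : ℝ := ((n + 1).centralBinom : ℝ)
    have h2 : ((n : ℝ) + 1 + 1) ^ 2 * y ^ 2 = 4 * (2 * (n + 1) + 1) ^ 2 * x ^ 2 := by
      linear_combination (((n : ℝ) + 1 + 1) * y + 2 * (2 * (n + 1) + 1) * x) * h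
    rw [pow_succ]
    push_cast
    refine le_of_mul_le_mul_left ?_ hn
    calc ((n : ℝ) + 1 + 1) * (16 ^ (n + 1) * 16)
        ≤ ((n : ℝ) + 1 + 1) * ((4 * (n + 1) * x ^ 2) * 16) := by gcongr
      _ ≤ 4 * (4 * (2 * (n + 1) + 1) ^ 2 * x ^ 2) := by nlinarith [sq_nonneg x]
      _ = _ := by rw [← h2]; ring

lemma inv_sqrt_le_centralBinom {n : ℕ} (hn : 1 ≤ n) :
    1 / (2 * √(n : ℝ)) ≤ (1 / 4) ^ n * (n.centralBinom : ℝ) := by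
  obtain ⟨m, rfl⟩ := Nat.exists_eq_add_of_le' hn
  have hs : 0 < √((m + 1 : ℕ) : ℝ) := Real.sqrt_pos.2 (by positivity)
  rw [div_le_iff₀ (by positivity)]
  refine (sq_le_sq₀ (by norm_num) (by positivity)).1 ?_
  have h := sixteen_pow_le_mul_centralBinom_sq m
  have h16 : ((1 / 4 : ℝ) ^ (m + 1)) ^ 2 * 16 ^ (m + 1) = 1 := by
    rw [← pow_mul, mul_comm (m + 1) 2, pow_mul, ← mul_pow]; norm_num
  rw [mul_pow, mul_pow, mul_pow, Real.sq_sqrt (by positivity)]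
  push_cast
  calc (1 : ℝ) ^ 2 = ((1 / 4 : ℝ) ^ (m + 1)) ^ 2 * 16 ^ (m + 1) := by rw [h16]; norm_num
    _ ≤ ((1 / 4 : ℝ) ^ (m + 1)) ^ 2 * (4 * (m + 1) * ((m + 1).centralBinom : ℝ) ^ 2) := by gcongr
    _ = _ := by ring

lemma inv_sqrt_le_gammaFunctional_comp_half (ha : -1 < a) {n : ℕ} (hn : 1 ≤ n) :
    1 / (4 * √(n : ℝ)) ≤ laguerreNormSq a n * gammaFunctional a
      ((normalizedLaguerre a n * normalizedLaguerre a n).comp (C (1 / 2) * X)) := by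
  have hn' : (0 : ℝ) < n := by exact_mod_cast hn
  rw [gammaFunctional_comp_half_sq ha]
  have h : (n.centralBinom : ℝ) / 2 ≤ laguerreNormSq a n *
      ∑ k ∈ Finset.range (n + 1), (n.choose k : ℝ) ^ 2 * (laguerreNormSq a k)⁻¹ := by
    rw [div_le_iff₀ two_pos]
    refine le_of_mul_le_mul_left ?_ hn'
    rw [← two_mul_sum_mul_choose_sq]
    calc _ ≤ 2 * ∑ k ∈ Finset.range (n + 1),
          n * laguerreNormSq a n * ((n.choose k : ℝ) ^ 2 * (laguerreNormSq a k)⁻¹) := by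
            refine mul_le_mul_of_nonneg_left (Finset.sum_le_sum fun k hk => ?_) two_pos.le
            have hk : k ≤ n := by simpa [Nat.lt_succ_iff] using hk
            have hm : (k : ℝ) * laguerreNormSq a k ≤ n * laguerreNormSq a n :=
              mul_laguerreNormSq_monotone ha hk
            have hp := laguerreNormSq_pos ha k
            calc (k : ℝ) * (n.choose k : ℝ) ^ 2
                = k * laguerreNormSq a k * ((n.choose k : ℝ) ^ 2 * (laguerreNormSq a k)⁻¹) := by
                  field_simp
              _ ≤ _ := by gcongr
      _ = _ := by rw [← Finset.mul_sum]; ring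
  calc 1 / (4 * √(n : ℝ)) = 1 / (2 * √(n : ℝ)) / 2 := by ring
    _ ≤ (1 / 4) ^ n * (n.centralBinom : ℝ) / 2 := by gcongr; exact inv_sqrt_le_centralBinom hn
    _ = (1 / 4) ^ n * ((n.centralBinom : ℝ) / 2) := by ring
    _ ≤ _ := (mul_le_mul_of_nonneg_left h (by positivity)).trans_eq (by ring)

end Algebra

section Integrals

variable {a : ℝ}

lemma laguerre_eq_eval (ha : -1 < a) (n : ℕ) (x : ℝ) :
    laguerre a n x = laguerreNormSq a n * (normalizedLaguerre a n).eval x := by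
  rw [laguerre, normalizedLaguerre, eval_finsetSum, Finset.mul_sum]
  refine Finset.sum_congr rfl fun j hj => ?_
  have hj : j ≤ n := by simpa [Nat.lt_succ_iff] using hj
  have h := (Gamma_natCast_add_pos ha j).ne'
  rw [Real.Gamma_nat_eq_factorial, eval_monomial, laguerreNormSq, Nat.cast_choose ℝ hj, neg_pow]
  field_simp

lemma laguerreFun_sq (ha : -1 < a) (n : ℕ) (x : ℝ) :
    laguerreFun a n x ^ 2 = 2 * laguerreNormSq a n *
      (normalizedLaguerre a n * normalizedLaguerre a n).eval (x ^ 2) * Real.exp (-1 * x ^ 2) := by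
  have hG := Gamma_natCast_add_pos ha n
  have h : Real.exp (-x ^ 2 / 2) ^ 2 = Real.exp (-1 * x ^ 2) := by
    rw [← Real.exp_nat_mul]; congr 1; push_cast; ring
  rw [laguerreFun, mul_pow, mul_pow, Real.sq_sqrt (by positivity), h, laguerre_eq_eval ha,
    eval_mul, laguerreNormSq]
  field_simp

open MeasureTheory in
/-- Integrals of polynomials in `x²` against `x^{2a+1} e^{-bx²}`. -/
lemma integral_eval_sq_mul_exp (ha : -1 < a) {b : ℝ} (hb : 0 < b) (p : ℝ[X]) :
    IntegrableOn (fun x : ℝ => p.eval (x ^ 2) * Real.exp (-b * x ^ 2) * x ^ (2 * a + 1))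
      (Set.Ioi 0) ∧
    ∫ x in Set.Ioi (0 : ℝ), p.eval (x ^ 2) * Real.exp (-b * x ^ 2) * x ^ (2 * a + 1) =
      b ^ (-(a + 1)) / 2 * gammaFunctional a (p.comp (C (1 / b) * X)) := by
  induction p using Polynomial.induction_on' with
  | add p q hp hq =>
    have e : (fun x : ℝ => (p + q).eval (x ^ 2) * Real.exp (-b * x ^ 2) * x ^ (2 * a + 1)) =
        fun x : ℝ => p.eval (x ^ 2) * Real.exp (-b * x ^ 2) * x ^ (2 * a + 1) +
          q.eval (x ^ 2) * Real.exp (-b * x ^ 2) * x ^ (2 * a + 1) := by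
      funext x; rw [eval_add]; ring
    refine ⟨e ▸ hp.1.add hq.1, ?_⟩
    rw [e, integral_add hp.1 hq.1, hp.2, hq.2, add_comp, map_add]
    ring
  | monomial j c =>
    have hq : -1 < 2 * (j : ℝ) + (2 * a + 1) := by
      linarith [(Nat.cast_nonneg j : (0 : ℝ) ≤ j)]
    have e : Set.EqOn
        (fun x : ℝ => c * (x ^ (2 * (j : ℝ) + (2 * a + 1)) * Real.exp (-b * x ^ (2 : ℝ))))
        (fun x : ℝ => (monomial j c).eval (x ^ 2) * Real.exp (-b * x ^ 2) * x ^ (2 * a + 1))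
        (Set.Ioi 0) := by
      intro x hx
      have hx : 0 < x := hx
      simp only [eval_monomial]
      rw [Real.rpow_add hx, Real.rpow_mul hx.le, Real.rpow_two, Real.rpow_natCast]
      ring
    refine ⟨IntegrableOn.congr_fun
      ((integrableOn_rpow_mul_exp_neg_mul_rpow hq two_pos hb).const_mul c) e measurableSet_Ioi, ?_⟩
    rw [← setIntegral_congr_fun measurableSet_Ioi e, integral_const_mul,
      integral_rpow_mul_exp_neg_mul_rpow two_pos hq hb, monomial_comp, mul_pow, ← C_pow,
      ← mul_assoc (C c), ← C_mul, C_mul_X_pow_eq_monomial, gammaFunctional_monomial,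
      show -(2 * (j : ℝ) + (2 * a + 1) + 1) / 2 = -(a + 1) + -(j : ℝ) by ring,
      show (2 * (j : ℝ) + (2 * a + 1) + 1) / 2 = j + a + 1 by ring,
      Real.rpow_add hb, Real.rpow_neg hb.le (j : ℝ), Real.rpow_natCast,
      one_div_pow]
    field_simp

open MeasureTheory in
lemma integral_laguerreFun_sq_mul_eval (ha : -1 < a) (n : ℕ) (p : ℝ[X]) :
    IntegrableOn (fun x : ℝ => laguerreFun a n x ^ 2 * p.eval (x ^ 2) * x ^ (2 * a + 1))
      (Set.Ioi 0) ∧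
    ∫ x in Set.Ioi (0 : ℝ), laguerreFun a n x ^ 2 * p.eval (x ^ 2) * x ^ (2 * a + 1) =
      laguerreNormSq a n *
        gammaFunctional a (p * (normalizedLaguerre a n * normalizedLaguerre a n)) := by
  have e : (fun x : ℝ => laguerreFun a n x ^ 2 * p.eval (x ^ 2) * x ^ (2 * a + 1)) = fun x =>
      2 * laguerreNormSq a n * ((p * (normalizedLaguerre a n * normalizedLaguerre a n)).eval
        (x ^ 2) * Real.exp (-1 * x ^ 2) * x ^ (2 * a + 1)) := by
    funext x
    rw [laguerreFun_sq ha, eval_mul (p := p)]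
    ring
  have h := integral_eval_sq_mul_exp ha one_pos
    (p * (normalizedLaguerre a n * normalizedLaguerre a n))
  refine ⟨e ▸ h.1.const_mul _, ?_⟩
  rw [e, integral_const_mul, h.2]
  simp
  ring

open MeasureTheory in
lemma integral_laguerreFun_sq_mul_exp (ha : -1 < a) (n : ℕ) :
    IntegrableOn (fun x : ℝ => laguerreFun a n x ^ 2 * Real.exp (-x ^ 2) * x ^ (2 * a + 1))
      (Set.Ioi 0) ∧
    ∫ x in Set.Ioi (0 : ℝ), laguerreFun a n x ^ 2 * Real.exp (-x ^ 2) * x ^ (2 * a + 1) =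
      2 ^ (-(a + 1)) * (laguerreNormSq a n * gammaFunctional a
        ((normalizedLaguerre a n * normalizedLaguerre a n).comp (C (1 / 2) * X))) := by
  have e : (fun x : ℝ => laguerreFun a n x ^ 2 * Real.exp (-x ^ 2) * x ^ (2 * a + 1)) = fun x =>
      2 * laguerreNormSq a n * ((normalizedLaguerre a n * normalizedLaguerre a n).eval
        (x ^ 2) * Real.exp (-2 * x ^ 2) * x ^ (2 * a + 1)) := by
    funext x
    rw [laguerreFun_sq ha, show (-2 : ℝ) * x ^ 2 = -1 * x ^ 2 + -x ^ 2 by ring, Real.exp_add]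
    ring
  have h := integral_eval_sq_mul_exp ha two_pos
    (normalizedLaguerre a n * normalizedLaguerre a n)
  refine ⟨e ▸ h.1.const_mul _, ?_⟩
  rw [e, integral_const_mul, h.2]
  ring

lemma continuous_laguerreFun (n : ℕ) : Continuous (laguerreFun a n) := by
  unfold laguerreFun laguerre
  fun_prop

open MeasureTheory in
lemma integrableOn_laguerreFun_sq_mul_one_add_rpow (ha : -1 < a) (n : ℕ) (γ : ℝ) :
    IntegrableOn (fun x : ℝ => laguerreFun a n x ^ 2 * (1 + x) ^ γ * x ^ (2 * a + 1))
      (Set.Ioi 0) := by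
  obtain ⟨m, hm⟩ := exists_nat_ge γ
  refine (integral_laguerreFun_sq_mul_eval ha n ((C 2 + C 2 * X) ^ m)).1.mono' ?_ ?_
  · refine Measurable.aestronglyMeasurable ?_
    have := (continuous_laguerreFun (a := a) n).measurable
    fun_prop
  · filter_upwards [ae_restrict_mem measurableSet_Ioi] with x hx
    have hx : 0 < x := hx
    rw [Real.norm_of_nonneg (by positivity)]
    have h : (1 + x) ^ γ ≤ eval (x ^ 2) ((C 2 + C 2 * X) ^ m) := by
      calc (1 + x) ^ γ ≤ (1 + x) ^ (m : ℝ) := Real.rpow_le_rpow_of_exponent_le (by linarith) hm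
        _ = (1 + x) ^ m := Real.rpow_natCast _ _
        _ ≤ (2 + 2 * x ^ 2) ^ m := by
          refine pow_le_pow_left₀ (by positivity) ?_ m
          nlinarith [sq_nonneg (x - 1)]
        _ = _ := by simp
    gcongr

open MeasureTheory in
/-- A pointwise lower bound of the weight by `f` bounds the weighted integral below. -/
lemma integral_le_integral_of_le_one_add_rpow (ha : -1 < a) (n : ℕ) (γ : ℝ) {f : ℝ → ℝ}
    (hf : IntegrableOn (fun x : ℝ => laguerreFun a n x ^ 2 * f x * x ^ (2 * a + 1)) (Set.Ioi 0))
    (h : ∀ x, 0 < x → f x ≤ (1 + x) ^ γ) :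
    ∫ x in Set.Ioi (0 : ℝ), laguerreFun a n x ^ 2 * f x * x ^ (2 * a + 1) ≤
      ∫ x in Set.Ioi (0 : ℝ), laguerreFun a n x ^ 2 * (1 + x) ^ γ * x ^ (2 * a + 1) := by
  refine setIntegral_mono_on hf (integrableOn_laguerreFun_sq_mul_one_add_rpow ha n γ)
    measurableSet_Ioi fun x hx => ?_
  have hx : 0 < x := hx
  have := h x hx
  gcongr

/-- The integral of a quadratic polynomial in `x²` against the Laguerre probability density. -/
lemma laguerreNormSq_mul_gammaFunctional_quadratic (ha : -1 < a) (n : ℕ) (u v w : ℝ) :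
    laguerreNormSq a (n + 1) * gammaFunctional a ((C u + C v * X + C w * X ^ 2) *
      (normalizedLaguerre a (n + 1) * normalizedLaguerre a (n + 1))) =
      u + v * (2 * (n + 1 : ℝ) + a + 1) +
        w * ((2 * (n + 1 : ℝ) + a + 1) ^ 2 + (n + 2) * (n + a + 2) + (n + 1) * (n + 1 + a)) := by
  have h := (laguerreNormSq_pos ha (n + 1)).ne'
  set P := normalizedLaguerre a (n + 1) with hP
  have e : (C u + C v * X + C w * X ^ 2) * (P * P) =
      u • (P * P) + v • (X * P * P) + w • ((X * P) * (X * P)) := by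
    simp only [smul_eq_C_mul]; ring
  rw [e, map_add, map_add, map_smul, map_smul, map_smul, hP, gammaFunctional_mul_self ha,
    gammaFunctional_X_mul_sq ha, gammaFunctional_X_mul_mul_X_mul ha]
  simp only [smul_eq_mul]
  field_simp

lemma lower_bound_one_add_rpow (ha : -1 < a) {β : ℝ} (hβ : 0 ≤ β) {n : ℕ} (hn : 1 ≤ n)
    (hna : 4 * (a + 2) ≤ n) :
    1 / 8 * (n : ℝ) ^ (β / 2) ≤
      ∫ x in Set.Ioi (0 : ℝ), laguerreFun a n x ^ 2 * (1 + x) ^ β * x ^ (2 * a + 1) := by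
  have hn0 : (0 : ℝ) < n := by exact_mod_cast hn
  set c : ℝ := (n : ℝ) ^ (β / 2) / 2 with hc
  have hc0 : 0 < c := by positivity
  set p : ℝ[X] := C (-c) + C (c / n) * X + C (-c / (12 * n ^ 2)) * X ^ 2 with hp
  have hI := integral_laguerreFun_sq_mul_eval ha n p
  refine le_trans ?_ (integral_le_integral_of_le_one_add_rpow ha n β hI.1 fun x hx => ?_)
  · obtain ⟨m, rfl⟩ := Nat.exists_eq_add_of_le' hn
    rw [hI.2, hp, laguerreNormSq_mul_gammaFunctional_quadratic ha]
    push_cast at hna hn0 ⊢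
    have key : (1 : ℝ) / 4 ≤ -1 + (2 * (m + 1 : ℝ) + a + 1) / (m + 1) -
        ((2 * (m + 1 : ℝ) + a + 1) ^ 2 + (m + 2) * (m + a + 2) + (m + 1) * (m + 1 + a)) /
          (12 * (m + 1) ^ 2) := by
      rw [← sub_nonneg]
      have : 0 ≤ ((m : ℝ) + 1) * (m + 1 - 4 * (a + 2)) := by
        apply mul_nonneg hn0.le; linarith
      have : 0 ≤ ((m : ℝ) + 1 - 4 * (a + 2)) * (a + 2) := by
        apply mul_nonneg <;> linarith
      field_simp
      nlinarith
    rw [show (1 : ℝ) / 8 * ((m : ℝ) + 1) ^ (β / 2) = c * (1 / 4) by rw [hc]; push_cast; ring]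
    refine (mul_le_mul_of_nonneg_left key hc0.le).trans_eq ?_
    field_simp
    ring
  · have hs : p.eval (x ^ 2) = c * (x ^ 2 / n - 1 - (x ^ 2 / n) ^ 2 / 12) := by
      simp only [hp, eval_add, eval_mul, eval_C, eval_X, eval_pow]
      field_simp
      ring
    rw [hs]
    rcases le_or_gt (x ^ 2) n with h | h
    · have : x ^ 2 / n ≤ 1 := (div_le_one hn0).2 h
      exact (mul_nonpos_of_nonneg_of_nonpos hc0.le
        (by nlinarith [sq_nonneg (x ^ 2 / n)])).trans (by positivity)
    · calc c * (x ^ 2 / n - 1 - (x ^ 2 / n) ^ 2 / 12) ≤ c * 2 := by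
            gcongr; nlinarith [sq_nonneg (x ^ 2 / n - 6)]
        _ = (n : ℝ) ^ (β / 2) := by rw [hc]; ring
        _ ≤ (x ^ 2) ^ (β / 2) := by gcongr
        _ = x ^ β := by
          rw [← Real.rpow_two, ← Real.rpow_mul hx.le]; congr 1; ring
        _ ≤ (1 + x) ^ β := by gcongr; linarith

lemma lower_bound_one_add_rpow_neg (ha : -1 < a) {β : ℝ} (hβ : 0 ≤ β) {n : ℕ} (hn : 1 ≤ n)
    (hna : a + 1 ≤ n) :
    3 ^ (-β) / 4 * (n : ℝ) ^ (-β / 2) ≤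
      ∫ x in Set.Ioi (0 : ℝ), laguerreFun a n x ^ 2 * (1 + x) ^ (-β) * x ^ (2 * a + 1) := by
  have hn1 : (1 : ℝ) ≤ n := by exact_mod_cast hn
  have hn0 : (0 : ℝ) < n := by linarith
  set c : ℝ := 3 ^ (-β) * (n : ℝ) ^ (-β / 2) with hc
  have hc0 : 0 < c := by positivity
  set p : ℝ[X] := C c + C (-c / (4 * n)) * X + C 0 * X ^ 2 with hp
  have hI := integral_laguerreFun_sq_mul_eval ha n p
  refine le_trans ?_ (integral_le_integral_of_le_one_add_rpow ha n (-β) hI.1 fun x hx => ?_)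
  · obtain ⟨m, rfl⟩ := Nat.exists_eq_add_of_le' hn
    rw [hI.2, hp, laguerreNormSq_mul_gammaFunctional_quadratic ha]
    push_cast at hna hn0 ⊢
    have key : (1 : ℝ) / 4 ≤ 1 - (2 * (m + 1 : ℝ) + a + 1) / (4 * (m + 1)) := by
      rw [← sub_nonneg]
      field_simp
      linarith
    rw [show (3 : ℝ) ^ (-β) / 4 * ((m : ℝ) + 1) ^ (-β / 2) = c * (1 / 4) by
      rw [hc]; push_cast; ring]
    refine (mul_le_mul_of_nonneg_left key hc0.le).trans_eq ?_
    field_simp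
    ring
  · have hs : p.eval (x ^ 2) = c * (1 - x ^ 2 / (4 * n)) := by
      simp only [hp, eval_add, eval_mul, eval_C, eval_X, eval_pow]
      field_simp
      ring
    rw [hs]
    rcases le_or_gt (x ^ 2) (4 * n) with h | h
    · have hx' : 1 + x ≤ 3 * √(n : ℝ) := by
        have h1 : 1 ≤ √(n : ℝ) := Real.one_le_sqrt.2 hn1
        have h2 : x ≤ 2 * √(n : ℝ) := by
          refine le_of_sq_le_sq ?_ (by positivity)
          rw [mul_pow, Real.sq_sqrt hn0.le]
          linarith
        linarith
      calc c * (1 - x ^ 2 / (4 * n)) ≤ c * 1 := by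
            gcongr; linarith [show 0 ≤ x ^ 2 / (4 * n) by positivity]
        _ = (3 * √(n : ℝ)) ^ (-β) := by
          rw [Real.mul_rpow (by norm_num) (by positivity), Real.sqrt_eq_rpow,
            ← Real.rpow_mul hn0.le, hc, mul_one]
          congr 2; ring
        _ ≤ (1 + x) ^ (-β) :=
          Real.rpow_le_rpow_of_nonpos (by linarith) hx' (by linarith)
    · have : 1 < x ^ 2 / (4 * n) := (one_lt_div (by positivity)).2 h
      exact (mul_nonpos_of_nonneg_of_nonpos hc0.le (by linarith)).trans (by positivity)

lemma lower_bound_inv_sqrt (ha : -1 < a) {β : ℝ} (hβ : 0 ≤ β) {n : ℕ} (hn : 1 ≤ n) :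
    Real.exp (-(β ^ 2 / 4)) * 2 ^ (-(a + 1)) / 4 * (n : ℝ) ^ (-(1 / 2) : ℝ) ≤
      ∫ x in Set.Ioi (0 : ℝ), laguerreFun a n x ^ 2 * (1 + x) ^ (-β) * x ^ (2 * a + 1) := by
  have hn0 : (0 : ℝ) < n := by exact_mod_cast hn
  set c := Real.exp (-(β ^ 2 / 4))
  have e : (fun x : ℝ => laguerreFun a n x ^ 2 * (c * Real.exp (-x ^ 2)) * x ^ (2 * a + 1)) =
      fun x => c * (laguerreFun a n x ^ 2 * Real.exp (-x ^ 2) * x ^ (2 * a + 1)) := by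
    funext x; ring
  have hI := integral_laguerreFun_sq_mul_exp ha n
  refine le_trans ?_ (integral_le_integral_of_le_one_add_rpow ha n (-β)
    (f := fun x => c * Real.exp (-x ^ 2)) (e ▸ hI.1.const_mul c) fun x hx => ?_)
  · rw [e, MeasureTheory.integral_const_mul, hI.2, Real.rpow_neg hn0.le, ← Real.sqrt_eq_rpow]
    calc _ = c * (2 ^ (-(a + 1)) * (1 / (4 * √(n : ℝ)))) := by ring
      _ ≤ _ := by gcongr; exact inv_sqrt_le_gammaFunctional_comp_half ha hn
  · have hx1 : 0 < 1 + x := by linarith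
    rw [← Real.exp_add, Real.rpow_def_of_pos hx1, Real.exp_le_exp]
    have hl : Real.log (1 + x) ≤ x := by linarith [Real.log_le_sub_one_of_pos hx1]
    nlinarith [mul_le_mul_of_nonneg_right hl hβ, sq_nonneg (x - β / 2)]

end Integrals

end LaguerrePolynomials

/-- Weighted lower bounds for Laguerre functions, for large n. -/
theorem laguerreFun_weighted_lower_bounds (a : ℝ) (ha : -1 < a) (β : ℝ) (hβ : 0 ≤ β) :
    ∃ C : ℝ, 0 < C ∧ ∃ N : ℕ, ∀ n : ℕ, N ≤ n →
      C * (n : ℝ) ^ (β / 2) ≤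
          (∫ x in Set.Ioi (0 : ℝ),
            (laguerreFun a n x) ^ 2 * (1 + x) ^ β * x ^ (2 * a + 1)) ∧
      C * max ((n : ℝ) ^ (-β / 2)) ((n : ℝ) ^ (-(1 / 2) : ℝ)) ≤
          ∫ x in Set.Ioi (0 : ℝ),
            (laguerreFun a n x) ^ 2 * (1 + x) ^ (-β) * x ^ (2 * a + 1) := by
  obtain ⟨N, hN⟩ := exists_nat_ge (4 * (a + 2))
  set c₁ : ℝ := 3 ^ (-β) / 4
  set c₂ : ℝ := Real.exp (-(β ^ 2 / 4)) * 2 ^ (-(a + 1)) / 4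
  have h₁ : 0 < c₁ := by positivity
  have h₂ : 0 < c₂ := by positivity
  refine ⟨min (1 / 8) (min c₁ c₂), by positivity, N + 1, fun n hn => ?_⟩
  have hn1 : 1 ≤ n := by lia
  have hNn : (N : ℝ) ≤ n := by exact_mod_cast (by lia : N ≤ n)
  have hm₁ : min (1 / 8) (min c₁ c₂) ≤ c₁ := (min_le_right _ _).trans (min_le_left _ _)
  have hm₂ : min (1 / 8) (min c₁ c₂) ≤ c₂ := (min_le_right _ _).trans (min_le_right _ _)
  refine ⟨?_, ?_⟩
  · refine le_trans ?_ (lower_bound_one_add_rpow ha hβ hn1 (hN.trans hNn))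
    exact mul_le_mul_of_nonneg_right (min_le_left _ _) (by positivity)
  · rw [mul_max_of_nonneg _ _ (by positivity)]
    refine max_le ?_ ?_
    · refine le_trans ?_ (lower_bound_one_add_rpow_neg ha hβ hn1 (by linarith))
      exact mul_le_mul_of_nonneg_right hm₁ (by positivity)
    · refine le_trans ?_ (lower_bound_inv_sqrt ha hβ hn1)
      exact mul_le_mul_of_nonneg_right hm₂ (by positivity)
end

section
/- Let α > -1 and 1 ≤ q ≤ 2. Then ‖φ_n^{|α|_1+d-1}‖_{L^q((0,∞), r^{2|α|_1+2d-1}dr)} is comparable to n^{(|α|_1+d)(1/q - 1/2)} for large n: there exist constants c, C > 0 with c n^{(|α|_1+d)(1/q-1/2)} ≤ ‖φ_n^{|α|_1+d-1}‖_{L^q(r^{2|α|_1+2d-1}dr)} ≤ C n^{(|α|_1+d)(1/q-1/2)}. -/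
namespace Laguerre

open Polynomial Set MeasureTheory

/-- The Laguerre polynomial `L_n^a` divided by `Γ(n + a + 1) / n!`. -/
noncomputable def reduced (a : ℝ) (n : ℕ) : ℝ[X] :=
  ∑ j ∈ Finset.range (n + 1), C ((-1) ^ j * n.choose j / Real.Gamma (j + a + 1)) * X ^ j

theorem coeff_reduced (a : ℝ) (n j : ℕ) :
    (reduced a n).coeff j = (-1) ^ j * n.choose j / Real.Gamma (j + a + 1) := by
  simp only [reduced, finsetSum_coeff, coeff_C_mul_X_pow]
  rw [Finset.sum_ite_eq]
  split_ifs with h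
  · rfl
  · rw [Nat.choose_eq_zero_of_lt (by simpa using h)]
    simp

theorem natDegree_reduced_le (a : ℝ) (n : ℕ) : (reduced a n).natDegree ≤ n := by
  rw [natDegree_le_iff_coeff_eq_zero]
  intro j hj
  rw [coeff_reduced, Nat.choose_eq_zero_of_lt hj]
  simp

variable {a : ℝ}

theorem Gamma_nat_add_pos (ha : -1 < a) (n : ℕ) : 0 < Real.Gamma (n + a + 1) :=
  Real.Gamma_pos_of_pos (by have : (0 : ℝ) ≤ n := n.cast_nonneg; linarith)

theorem Gamma_succ_add (ha : -1 < a) (n : ℕ) :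
    Real.Gamma ((n + 1 : ℕ) + a + 1) = (n + a + 1) * Real.Gamma (n + a + 1) := by
  rw [← Real.Gamma_add_one (by have : (0 : ℝ) ≤ n := n.cast_nonneg; linarith)]
  push_cast
  ring_nf

theorem laguerre_eq_eval_reduced (a : ℝ) (n : ℕ) (x : ℝ) :
    laguerre a n x = Real.Gamma (n + a + 1) / n.factorial * (reduced a n).eval x := by
  simp only [laguerre, reduced, eval_finsetSum, eval_mul, eval_C, eval_pow, eval_X,
    Finset.mul_sum]
  refine Finset.sum_congr rfl fun j hj => ?_
  rw [Real.Gamma_nat_eq_factorial, Nat.cast_choose ℝ (Finset.mem_range_succ_iff.1 hj), neg_pow]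
  have h1 : (n.factorial : ℝ) ≠ 0 := by positivity
  have h2 : ((n - j).factorial : ℝ) ≠ 0 := by positivity
  have h3 : (j.factorial : ℝ) ≠ 0 := by positivity
  field_simp

theorem X_mul_reduced (ha : -1 < a) (n : ℕ) :
    X * reduced a n = C (-(n + a + 1)) * reduced a (n + 1) + C (2 * n + a + 1) * reduced a n
      - C (n : ℝ) * reduced a (n - 1) := by
  ext j
  cases j with
  | zero =>
    simp only [mul_coeff_zero, coeff_X_zero, coeff_sub, coeff_add, coeff_C_zero, coeff_reduced]
    simp
    ring
  | succ j =>
    simp only [coeff_X_mul, coeff_sub, coeff_add, coeff_C_mul, coeff_reduced, Gamma_succ_add ha]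
    have h0 : (j : ℝ) + a + 1 ≠ 0 := by have : (0 : ℝ) ≤ j := j.cast_nonneg; linarith
    have hG := (Gamma_nat_add_pos ha j).ne'
    have key : ((j : ℝ) + a + 1) * n.choose j = (n + a + 1) * (n + 1).choose (j + 1)
        - (2 * n + a + 1) * n.choose (j + 1) + n * (n - 1).choose (j + 1) := by
      cases n with
      | zero =>
        cases j <;> simp [Nat.choose_eq_zero_of_lt]
      | succ m =>
        have e1 := congrArg (Nat.cast (R := ℝ)) (Nat.add_one_mul_choose_eq (m + 1) j)
        have e2 := congrArg (Nat.cast (R := ℝ)) (Nat.add_one_mul_choose_eq m j)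
        have e3 := congrArg (Nat.cast (R := ℝ)) (Nat.choose_succ_succ (m + 1) j)
        have e4 := congrArg (Nat.cast (R := ℝ)) (Nat.choose_succ_succ m j)
        simp only [Nat.succ_eq_add_one, Nat.add_sub_cancel] at *
        push_cast at *
        linear_combination (-1 : ℝ) * e1 + e2 + (-(m : ℝ) - 3 - a - j) * e3
          + ((m : ℝ) + 1) * e4
    field_simp
    rw [pow_succ]
    linear_combination (-1) ^ j * key

theorem X_mul_derivative_reduced (n : ℕ) :
    X * derivative (reduced a n) = C (n : ℝ) * (reduced a n - reduced a (n - 1)) := by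
  ext j
  cases j with
  | zero =>
    simp only [mul_coeff_zero, coeff_X_zero, coeff_sub, coeff_C_zero, coeff_reduced]
    simp
  | succ j =>
    simp only [coeff_X_mul, coeff_sub, coeff_C_mul, coeff_reduced, coeff_derivative]
    have key : n.choose (j + 1) * ((j : ℝ) + 1) = n * (n.choose (j + 1) - (n - 1).choose (j + 1)) := by
      cases n with
      | zero => simp
      | succ m =>
        have e2 := congrArg (Nat.cast (R := ℝ)) (Nat.add_one_mul_choose_eq m j)
        have e4 := congrArg (Nat.cast (R := ℝ)) (Nat.choose_succ_succ m j)
        simp only [Nat.succ_eq_add_one, Nat.add_sub_cancel] at *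
        push_cast at *
        linear_combination (-1 : ℝ) * e2 - ((m : ℝ) + 1) * e4
    linear_combination (-1) ^ (j + 1) / Real.Gamma ((j + 1 : ℕ) + a + 1) * key

/-- The functional `p ↦ ∫₀^∞ p(x) x^a e^{-x} dx` on polynomials, given by its moments. -/
noncomputable def moment (a : ℝ) : ℝ[X] →ₗ[ℝ] ℝ :=
  Polynomial.lsum fun k => LinearMap.mulRight ℝ (Real.Gamma (k + a + 1))

theorem moment_C_mul_X_pow (c : ℝ) (k : ℕ) :
    moment a (C c * X ^ k) = c * Real.Gamma (k + a + 1) := by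
  simp [moment, Polynomial.lsum_apply, C_mul_X_pow_eq_monomial, sum_monomial_index]

theorem moment_C_mul (c : ℝ) (p : ℝ[X]) : moment a (C c * p) = c * moment a p := by
  rw [← smul_eq_C_mul, map_smul, smul_eq_mul]

theorem moment_reduced (ha : -1 < a) (n : ℕ) :
    moment a (reduced a n) = if n = 0 then 1 else 0 := by
  rw [reduced, map_sum]
  simp only [moment_C_mul_X_pow]
  rw [Finset.sum_congr rfl fun j _ => div_mul_cancel₀ _ (Gamma_nat_add_pos ha j).ne']
  exact_mod_cast Int.alternating_sum_range_choose (n := n)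

theorem moment_X_pow_succ_mul_reduced (ha : -1 < a) (k n : ℕ) :
    moment a (X ^ (k + 1) * reduced a n) = -(n + a + 1) * moment a (X ^ k * reduced a (n + 1))
      + (2 * n + a + 1) * moment a (X ^ k * reduced a n)
      - n * moment a (X ^ k * reduced a (n - 1)) := by
  rw [← moment_C_mul, ← moment_C_mul, ← moment_C_mul, ← map_add, ← map_sub]
  congr 1
  linear_combination X ^ k * X_mul_reduced ha n

theorem moment_X_pow_mul_reduced_of_lt (ha : -1 < a) {k n : ℕ} (h : k < n) :
    moment a (X ^ k * reduced a n) = 0 := by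
  induction k generalizing n with
  | zero => simp [moment_reduced ha, h.ne']
  | succ k ih =>
    rw [moment_X_pow_succ_mul_reduced ha, ih (by omega), ih (by omega), ih (by omega)]
    simp

theorem moment_X_pow_mul_reduced_self (ha : -1 < a) (n : ℕ) :
    moment a (X ^ n * reduced a n) = (-1) ^ n * n.factorial := by
  induction n with
  | zero => simp [moment_reduced ha]
  | succ n ih =>
    rw [moment_X_pow_succ_mul_reduced ha, moment_X_pow_mul_reduced_of_lt ha (by omega),
      moment_X_pow_mul_reduced_of_lt ha (by omega), Nat.add_sub_cancel, ih, Nat.factorial_succ]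
    push_cast
    ring

theorem moment_mul_reduced_of_natDegree_lt (ha : -1 < a) {p : ℝ[X]} {n : ℕ}
    (h : p.natDegree < n) : moment a (p * reduced a n) = 0 := by
  rw [p.as_sum_range_C_mul_X_pow, Finset.sum_mul, map_sum]
  refine Finset.sum_eq_zero fun j hj => ?_
  rw [mul_assoc, moment_C_mul, moment_X_pow_mul_reduced_of_lt ha, mul_zero]
  have := Finset.mem_range.1 hj
  omega

theorem moment_reduced_mul_reduced_of_lt (ha : -1 < a) {m n : ℕ} (h : m < n) :
    moment a (reduced a m * reduced a n) = 0 :=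
  moment_mul_reduced_of_natDegree_lt ha ((natDegree_reduced_le a m).trans_lt h)

/-- The square of the `L²(x^a e^{-x} dx)` norm of `reduced a n`. -/
noncomputable def normSq (a : ℝ) (n : ℕ) : ℝ :=
  n.factorial / Real.Gamma (n + a + 1)

theorem normSq_pos (ha : -1 < a) (n : ℕ) : 0 < normSq a n :=
  div_pos (by positivity) (Gamma_nat_add_pos ha n)

theorem normSq_succ (ha : -1 < a) (n : ℕ) :
    (n + a + 1) * normSq a (n + 1) = (n + 1) * normSq a n := by
  have h0 : (n : ℝ) + a + 1 ≠ 0 := by have : (0 : ℝ) ≤ n := n.cast_nonneg; linarith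
  have hG := (Gamma_nat_add_pos ha n).ne'
  rw [normSq, normSq, Gamma_succ_add ha, Nat.factorial_succ]
  push_cast
  field_simp

theorem normSq_pred (ha : -1 < a) {n : ℕ} (hn : n ≠ 0) :
    n * normSq a (n - 1) = (n + a) * normSq a n := by
  obtain ⟨m, rfl⟩ := Nat.exists_eq_succ_of_ne_zero hn
  have := normSq_succ ha m
  simp only [Nat.succ_eq_add_one, Nat.add_sub_cancel]
  push_cast
  linarith

theorem moment_reduced_sq (ha : -1 < a) (n : ℕ) :
    moment a (reduced a n * reduced a n) = normSq a n := by
  have h : moment a ((∑ j ∈ Finset.range (n + 1),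
      C ((-1) ^ j * n.choose j / Real.Gamma (j + a + 1)) * X ^ j) * reduced a n)
      = normSq a n := by
    rw [Finset.sum_mul, map_sum, Finset.sum_range_succ, Finset.sum_eq_zero, zero_add, mul_assoc,
      moment_C_mul, moment_X_pow_mul_reduced_self ha, normSq, Nat.choose_self]
    · have : ((-1 : ℝ) ^ n) * (-1) ^ n = 1 := by rw [← mul_pow]; simp
      push_cast
      linear_combination (n.factorial / Real.Gamma (n + a + 1)) * this
    · intro j hj
      rw [mul_assoc, moment_C_mul, moment_X_pow_mul_reduced_of_lt ha (Finset.mem_range.1 hj),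
        mul_zero]
  exact h

theorem moment_X_mul_reduced_sq (ha : -1 < a) {n : ℕ} (hn : n ≠ 0) :
    moment a (X * (reduced a n * reduced a n)) = (2 * n + a + 1) * normSq a n := by
  have e : X * (reduced a n * reduced a n) =
      C (-(n + a + 1)) * (reduced a n * reduced a (n + 1))
        + C (2 * n + a + 1) * (reduced a n * reduced a n)
        - C (n : ℝ) * (reduced a (n - 1) * reduced a n) := by
    linear_combination reduced a n * X_mul_reduced ha n
  rw [e, map_sub, map_add, moment_C_mul, moment_C_mul, moment_C_mul, moment_reduced_sq ha,
    moment_reduced_mul_reduced_of_lt ha (Nat.lt_succ_self n),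
    moment_reduced_mul_reduced_of_lt ha (by omega : n - 1 < n)]
  ring

theorem moment_X_sq_mul_reduced_sq (ha : -1 < a) {n : ℕ} (hn : n ≠ 0) :
    moment a (X ^ 2 * (reduced a n * reduced a n)) =
      ((n + 1) * (n + a + 1) + (2 * n + a + 1) ^ 2 + n * (n + a)) * normSq a n := by
  have e : X ^ 2 * (reduced a n * reduced a n) =
      C ((n + a + 1) ^ 2) * (reduced a (n + 1) * reduced a (n + 1))
        + C ((2 * n + a + 1) ^ 2) * (reduced a n * reduced a n)
        + C ((n : ℝ) ^ 2) * (reduced a (n - 1) * reduced a (n - 1))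
        + C (-2 * (n + a + 1) * (2 * n + a + 1)) * (reduced a n * reduced a (n + 1))
        + C (-2 * (2 * n + a + 1) * n) * (reduced a (n - 1) * reduced a n)
        + C (2 * (n + a + 1) * n) * (reduced a (n - 1) * reduced a (n + 1)) := by
    have h := X_mul_reduced ha n
    have : X ^ 2 * (reduced a n * reduced a n) = (X * reduced a n) * (X * reduced a n) := by ring
    rw [this, h]
    simp only [map_mul, map_add, map_neg, map_pow, map_one, map_ofNat]
    ring
  rw [e]
  simp only [map_add, moment_C_mul, moment_reduced_sq ha]
  rw [moment_reduced_mul_reduced_of_lt ha (Nat.lt_succ_self n),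
    moment_reduced_mul_reduced_of_lt ha (by omega : n - 1 < n),
    moment_reduced_mul_reduced_of_lt ha (by omega : n - 1 < n + 1)]
  linear_combination ((n : ℝ) + a + 1) * normSq_succ ha n + n * normSq_pred ha hn

theorem integrableOn_eval_mul (ha : -1 < a) {b : ℝ} (hb : 0 < b) (p : ℝ[X]) :
    IntegrableOn (fun x : ℝ => p.eval x * (x ^ a * Real.exp (-b * x))) (Ioi 0) := by
  induction p using Polynomial.induction_on' with
  | add p q hp hq =>
    simp only [eval_add, add_mul]
    exact hp.add hq
  | monomial k c =>
    have h := (integrableOn_rpow_mul_exp_neg_mul_rpow (p := 1) (s := k + a) (b := b)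
      (by have : (0 : ℝ) ≤ k := k.cast_nonneg; linarith) one_pos hb).const_mul c
    refine IntegrableOn.congr_fun h (fun x (hx : 0 < x) => ?_) measurableSet_Ioi
    simp only [eval_monomial, Real.rpow_one, Real.rpow_add hx, Real.rpow_natCast]
    ring

theorem integrableOn_eval_mul_weight (ha : -1 < a) (p : ℝ[X]) :
    IntegrableOn (fun x : ℝ => p.eval x * (x ^ a * Real.exp (-x))) (Ioi 0) := by
  simpa using integrableOn_eval_mul ha one_pos p

theorem moment_eq_integral (ha : -1 < a) (p : ℝ[X]) :
    moment a p = ∫ x in Ioi (0 : ℝ), p.eval x * (x ^ a * Real.exp (-x)) := by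
  induction p using Polynomial.induction_on' with
  | add p q hp hq =>
    simp only [eval_add, add_mul]
    rw [map_add, hp, hq, integral_add (integrableOn_eval_mul_weight ha p)
      (integrableOn_eval_mul_weight ha q)]
  | monomial k c =>
    rw [← C_mul_X_pow_eq_monomial, moment_C_mul_X_pow, Real.Gamma_eq_integral
      (by have : (0 : ℝ) ≤ k := k.cast_nonneg; linarith), ← integral_const_mul]
    refine setIntegral_congr_fun measurableSet_Ioi fun x (hx : 0 < x) => ?_
    simp only [eval_mul, eval_C, eval_pow, eval_X, add_sub_cancel_right, Real.rpow_add hx,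
      Real.rpow_natCast]
    ring

theorem moment_mono (ha : -1 < a) {p q : ℝ[X]} (h : ∀ x, 0 < x → p.eval x ≤ q.eval x) :
    moment a p ≤ moment a q := by
  rw [moment_eq_integral ha, moment_eq_integral ha]
  refine setIntegral_mono_on (integrableOn_eval_mul_weight ha p)
    (integrableOn_eval_mul_weight ha q) measurableSet_Ioi fun x (hx : 0 < x) => ?_
  exact mul_le_mul_of_nonneg_right (h x hx) (by positivity)

theorem moment_X_pow_even_le (ha : -1 < a) (m : ℕ) : ∃ K : ℝ, 0 < K ∧ ∀ n : ℕ,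
    moment a (X ^ (2 * m) * (reduced a n * reduced a n)) ≤ K * (n + 1) ^ (2 * m) * normSq a n := by
  induction m with
  | zero => exact ⟨1, one_pos, fun n => by simp [moment_reduced_sq ha]⟩
  | succ m ih =>
    obtain ⟨K, hK, h⟩ := ih
    set A := |a| + 1 with hA
    have hA1 : 1 ≤ A := by have := abs_nonneg a; linarith
    refine ⟨3 * (2 ^ (2 * m) * A + 4 * A ^ 2 + A) * K, by positivity, fun n => ?_⟩
    have hn0 : (0 : ℝ) ≤ n := n.cast_nonneg
    have haA : a + 1 ≤ A := by have := le_abs_self a; linarith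
    have hle : (n : ℝ) + a + 1 ≤ A * (n + 1) := by nlinarith
    have hle2 : 2 * (n : ℝ) + a + 1 ≤ 2 * A * (n + 1) := by nlinarith
    have hpos : 0 < (n : ℝ) + a + 1 := by linarith
    have hN := normSq_pos ha n
    have hbound : moment a (X ^ (2 * (m + 1)) * (reduced a n * reduced a n)) ≤
        3 * ((n + a + 1) ^ 2 * moment a (X ^ (2 * m) * (reduced a (n + 1) * reduced a (n + 1)))
          + (2 * n + a + 1) ^ 2 * moment a (X ^ (2 * m) * (reduced a n * reduced a n))
          + n ^ 2 * moment a (X ^ (2 * m) * (reduced a (n - 1) * reduced a (n - 1)))) := by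
      rw [← moment_C_mul, ← moment_C_mul, ← moment_C_mul, ← map_add, ← map_add, ← moment_C_mul]
      refine moment_mono ha fun x _ => ?_
      have hrec := congrArg (eval x) (X_mul_reduced ha n)
      simp only [eval_mul, eval_add, eval_sub, eval_C, eval_X, eval_pow] at hrec ⊢
      set u := eval x (reduced a n)
      set v := eval x (reduced a (n + 1))
      set w := eval x (reduced a (n - 1))
      have e : x ^ (2 * (m + 1)) * (u * u) = x ^ (2 * m) * (x * u) ^ 2 := by ring
      have hx : 0 ≤ x ^ (2 * m) := by rw [pow_mul]; positivity
      rw [e, hrec]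
      have key : (-(n + a + 1) * v + (2 * n + a + 1) * u - n * w) ^ 2 ≤
          3 * (((n + a + 1) * v) ^ 2 + ((2 * n + a + 1) * u) ^ 2 + (n * w) ^ 2) := by
        nlinarith [sq_nonneg ((n + a + 1) * v + (2 * n + a + 1) * u),
          sq_nonneg ((n + a + 1) * v - n * w), sq_nonneg ((2 * n + a + 1) * u + n * w)]
      refine (mul_le_mul_of_nonneg_left key hx).trans_eq ?_
      ring
    have h1 : (n + a + 1) ^ 2 * moment a (X ^ (2 * m) * (reduced a (n + 1) * reduced a (n + 1)))
        ≤ 2 ^ (2 * m) * A * K * (n + 1) ^ (2 * (m + 1)) * normSq a n := by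
      calc _ ≤ (n + a + 1) ^ 2 * (K * ((n + 1 : ℕ) + 1) ^ (2 * m) * normSq a (n + 1)) := by
            gcongr; exact h (n + 1)
        _ = K * ((n + 1 : ℕ) + 1) ^ (2 * m) * ((n + a + 1) * (n + 1)) * normSq a n := by
            linear_combination K * ((n + 1 : ℕ) + 1) ^ (2 * m) * (n + a + 1) * normSq_succ ha n
        _ ≤ K * (2 * (n + 1)) ^ (2 * m) * ((A * (n + 1)) * (n + 1)) * normSq a n := by
            gcongr; push_cast; linarith
        _ = _ := by rw [mul_pow]; ring
    have h2 : (2 * n + a + 1) ^ 2 * moment a (X ^ (2 * m) * (reduced a n * reduced a n))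
        ≤ 4 * A ^ 2 * K * (n + 1) ^ (2 * (m + 1)) * normSq a n := by
      calc _ ≤ (2 * A * (n + 1)) ^ 2 * (K * (n + 1) ^ (2 * m) * normSq a n) := by
            have : 0 ≤ 2 * (n : ℝ) + a + 1 := by linarith
            gcongr
            · rw [pow_mul]
              rw [← map_zero (moment a)]
              refine moment_mono ha fun x _ => ?_
              simp only [eval_zero, eval_mul, eval_pow, eval_X]
              exact mul_nonneg (by positivity) (mul_self_nonneg _)
            · exact h n
        _ = _ := by ring
    have h3 : n ^ 2 * moment a (X ^ (2 * m) * (reduced a (n - 1) * reduced a (n - 1)))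
        ≤ A * K * (n + 1) ^ (2 * (m + 1)) * normSq a n := by
      rcases eq_or_ne n 0 with rfl | hn
      · simp only [CharP.cast_eq_zero, ne_eq, OfNat.ofNat_ne_zero, not_false_eq_true, zero_pow,
          zero_mul]
        positivity
      have hcast : ((n - 1 : ℕ) : ℝ) + 1 = n := by
        rw [Nat.cast_sub (Nat.one_le_iff_ne_zero.2 hn)]; simp
      calc _ ≤ n ^ 2 * (K * ((n - 1 : ℕ) + 1) ^ (2 * m) * normSq a (n - 1)) := by
            gcongr; exact h (n - 1)
        _ = K * n ^ (2 * m) * (n * (n + a)) * normSq a n := by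
            rw [hcast]
            linear_combination K * n ^ (2 * m) * n * normSq_pred ha hn
        _ ≤ K * (n + 1) ^ (2 * m) * ((n + 1) * (A * (n + 1))) * normSq a n := by
            have : (1 : ℝ) ≤ n := by exact_mod_cast Nat.one_le_iff_ne_zero.2 hn
            have : 0 ≤ (n : ℝ) + a := by linarith
            gcongr <;> linarith
        _ = _ := by ring
    calc _ ≤ _ := hbound
      _ ≤ 3 * (2 ^ (2 * m) * A * K * (n + 1) ^ (2 * (m + 1)) * normSq a n
          + 4 * A ^ 2 * K * (n + 1) ^ (2 * (m + 1)) * normSq a n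
          + A * K * (n + 1) ^ (2 * (m + 1)) * normSq a n) := by gcongr
      _ = _ := by ring

theorem mul_eval_derivative_reduced_pred (ha : -1 < a) {n : ℕ} (hn : n ≠ 0) (x : ℝ) :
    x * (derivative (reduced a (n - 1))).eval x =
      (x - n - a) * (reduced a (n - 1)).eval x + (n + a) * (reduced a n).eval x := by
  obtain ⟨m, rfl⟩ := Nat.exists_eq_succ_of_ne_zero hn
  have h1 := congrArg (eval x) (X_mul_derivative_reduced (a := a) m)
  have h2 := congrArg (eval x) (X_mul_reduced ha m)
  simp only [eval_mul, eval_add, eval_sub, eval_C, eval_X, Nat.succ_eq_add_one,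
    Nat.add_sub_cancel, Nat.cast_add, Nat.cast_one] at *
  linear_combination h1 - h2

/-- The energy `x^{2a+2} y'² + x^{2a+1} (n + (a+1)/2 - x/4) y²` of `y = e^{-x/2} reduced a n`, a
solution of `x y'' + (a+1) y' + (n + (a+1)/2 - x/4) y = 0`. -/
noncomputable def energy (a : ℝ) (n : ℕ) (x : ℝ) : ℝ :=
  x ^ (2 * a) * Real.exp (-x) *
    ((n * ((reduced a n).eval x - (reduced a (n - 1)).eval x) - x / 2 * (reduced a n).eval x) ^ 2
      + x * (n + (a + 1) / 2 - x / 4) * (reduced a n).eval x ^ 2)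

theorem hasDerivAt_energy (ha : -1 < a) {n : ℕ} (hn : n ≠ 0) {x : ℝ} (hx : 0 < x) :
    HasDerivAt (energy a n)
      (x ^ (2 * a) * Real.exp (-x) * ((reduced a n).eval x ^ 2 *
        ((2 * a + 1) * (n + (a + 1) / 2) - (a + 1) * x / 2))) x := by
  have hP := (reduced a n).hasDerivAt x
  have hQ := (reduced a (n - 1)).hasDerivAt x
  have eP := congrArg (eval x) (X_mul_derivative_reduced (a := a) n)
  have eQ := mul_eval_derivative_reduced_pred ha hn x
  simp only [eval_mul, eval_sub, eval_C, eval_X] at eP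
  have hid := hasDerivAt_id x
  have hpow := Real.hasDerivAt_rpow_const (p := 2 * a) (Or.inl hx.ne')
  have hexp := (hasDerivAt_neg x).exp
  have hE := (hpow.mul hexp).mul
    (((((hP.sub hQ).const_mul (n : ℝ)).sub ((hid.div_const 2).mul hP)).pow 2).add
      ((hid.mul ((hid.div_const 4).const_sub (n + (a + 1) / 2))).mul (hP.pow 2)))
  refine hE.congr_deriv ?_
  simp only [Pi.mul_apply, Pi.sub_apply, Pi.pow_apply, Pi.add_apply, id]
  rw [Real.rpow_sub_one hx.ne']
  generalize eval x (reduced a n) = P at *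
  generalize eval x (reduced a (n - 1)) = Q at *
  generalize eval x (derivative (reduced a n)) = P' at *
  generalize eval x (derivative (reduced a (n - 1))) = Q' at *
  generalize x ^ (2 * a) = R
  obtain rfl : P' = n * (P - Q) / x := by field_simp; linarith
  obtain rfl : Q' = ((x - n - a) * Q + (n + a) * P) / x := by field_simp; linarith
  field_simp
  push_cast
  ring

theorem rpow_le_four_rpow_abs_mul {x y : ℝ} (hx : 0 < x) (hy : 0 < y) (hxy : x ≤ 4 * y)
    (hyx : y ≤ 4 * x) (a : ℝ) : x ^ a ≤ 4 ^ |a| * y ^ a := by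
  rcases le_total 0 a with h | h
  · rw [abs_of_nonneg h, ← Real.mul_rpow (by norm_num) hy.le]
    exact Real.rpow_le_rpow hx.le hxy h
  · rw [abs_of_nonpos h, Real.rpow_neg (by norm_num), ← Real.inv_rpow (by norm_num),
      ← Real.mul_rpow (by norm_num) hy.le]
    exact Real.rpow_le_rpow_of_nonpos (by positivity) (by linarith) h

theorem integral_reduced_sq (ha : -1 < a) (n : ℕ) :
    ∫ x in Ioi (0 : ℝ), (reduced a n).eval x ^ 2 * (x ^ a * Real.exp (-x)) = normSq a n := by
  rw [← moment_reduced_sq ha, moment_eq_integral ha]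
  simp only [eval_mul, sq]

theorem integrableOn_reduced_sq (ha : -1 < a) (n : ℕ) :
    IntegrableOn (fun x : ℝ => (reduced a n).eval x ^ 2 * (x ^ a * Real.exp (-x))) (Ioi 0) := by
  have h := integrableOn_eval_mul_weight ha (reduced a n ^ 2)
  exact h.congr_fun (fun x _ => by simp only [eval_pow]) measurableSet_Ioi

theorem setIntegral_reduced_sq_le (ha : -1 < a) (n : ℕ) {s : Set ℝ} (hs : s ⊆ Ioi 0) :
    ∫ x in s, (reduced a n).eval x ^ 2 * (x ^ a * Real.exp (-x)) ≤ normSq a n := by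
  rw [← integral_reduced_sq ha n]
  refine setIntegral_mono_set (integrableOn_reduced_sq ha n) ?_ hs.eventuallyLE
  filter_upwards [ae_restrict_mem measurableSet_Ioi] with x (hx : 0 < x)
  simp only [Pi.zero_apply]
  positivity

/-- In the oscillatory region, the energy at two points differs by at most `O(n^{a+1})`. -/
theorem energy_le_energy_add (ha : -1 < a) {n : ℕ} (hn : n ≠ 0) {x t : ℝ}
    (hx : x ∈ Icc ((n : ℝ) / 4) (15 * n / 4)) (ht : t ∈ Icc ((n : ℝ) / 4) (15 * n / 4)) :
    energy a n x ≤ energy a n t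
      + 4 ^ |a| * (n : ℝ) ^ a * (6 * (|a| + 1) ^ 2 * n) * normSq a n := by
  have hn1 : (1 : ℝ) ≤ n := by exact_mod_cast Nat.one_le_iff_ne_zero.2 hn
  have hsub : uIcc t x ⊆ Icc ((n : ℝ) / 4) (15 * n / 4) := uIcc_subset_Icc ht hx
  have hpos : ∀ s ∈ Icc ((n : ℝ) / 4) (15 * n / 4), 0 < s := fun s hs => by
    linarith [hs.1]
  have hsub0 : uIoc t x ⊆ Ioi 0 := fun s hs => hpos s (hsub (uIoc_subset_uIcc hs))
  set g : ℝ → ℝ := fun x => x ^ (2 * a) * Real.exp (-x) * ((reduced a n).eval x ^ 2 *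
        ((2 * a + 1) * (n + (a + 1) / 2) - (a + 1) * x / 2)) with hg
  have hcont : ContinuousOn g (uIcc t x) := by
    intro s hs
    have hs0 := hpos s (hsub hs)
    refine ContinuousAt.continuousWithinAt ?_
    have := Real.continuousAt_rpow_const s (2 * a) (Or.inl hs0.ne')
    have := (reduced a n).continuous.continuousAt (x := s)
    fun_prop
  have hFTC : ∫ s in t..x, g s = energy a n x - energy a n t :=
    intervalIntegral.integral_eq_sub_of_hasDerivAt
      (fun s hs => hasDerivAt_energy ha hn (hpos s (hsub hs))) hcont.intervalIntegrable
  set c := 4 ^ |a| * (n : ℝ) ^ a * (6 * (|a| + 1) ^ 2 * n) with hc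
  have hc0 : 0 ≤ c := by positivity
  have hle : ∀ s ∈ uIoc t x,
      ‖g s‖ ≤ c * ((reduced a n).eval s ^ 2 * (s ^ a * Real.exp (-s))) := by
    intro s hs
    have hsI := hsub (uIoc_subset_uIcc hs)
    have hs0 := hpos s hsI
    have h1 : s ^ a ≤ 4 ^ |a| * (n : ℝ) ^ a :=
      rpow_le_four_rpow_abs_mul hs0 (by linarith) (by linarith [hsI.2]) (by linarith [hsI.1]) a
    have h2 : |(2 * a + 1) * (n + (a + 1) / 2) - (a + 1) * s / 2| ≤ 6 * (|a| + 1) ^ 2 * n := by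
      have ha0 := abs_nonneg a
      have e1 : |2 * a + 1| ≤ 2 * (|a| + 1) := by
        rw [abs_le]; constructor <;> linarith [neg_abs_le a, le_abs_self a]
      have e2 : |(n : ℝ) + (a + 1) / 2| ≤ 2 * (|a| + 1) * n := by
        rw [abs_of_nonneg (by linarith)]
        nlinarith [le_abs_self a]
      have e3 : |(a + 1) * s / 2| ≤ (|a| + 1) * (2 * n) := by
        rw [abs_of_nonneg (div_nonneg (mul_nonneg (by linarith) hs0.le) zero_le_two), mul_div_assoc]
        exact mul_le_mul (by linarith [le_abs_self a]) (by linarith [hsI.2]) (by linarith)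
          (by linarith)
      calc _ ≤ |(2 * a + 1) * (n + (a + 1) / 2)| + |(a + 1) * s / 2| := abs_sub _ _
        _ ≤ 2 * (|a| + 1) * (2 * (|a| + 1) * n) + (|a| + 1) * (2 * n) := by
            rw [abs_mul]; gcongr
        _ ≤ _ := by nlinarith [mul_nonneg ha0 (by linarith : (0 : ℝ) ≤ n),
            mul_nonneg (mul_nonneg ha0 ha0) (by linarith : (0 : ℝ) ≤ n)]
    have e : s ^ (2 * a) = s ^ a * s ^ a := by rw [← Real.rpow_add hs0]; ring_nf
    rw [hg, Real.norm_eq_abs]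
    simp only [abs_mul]
    rw [abs_of_pos (Real.rpow_pos_of_pos hs0 _), Real.abs_exp, abs_of_nonneg (sq_nonneg _), e, hc]
    calc _ = s ^ a * |(2 * a + 1) * (n + (a + 1) / 2) - (a + 1) * s / 2|
          * ((reduced a n).eval s ^ 2 * (s ^ a * Real.exp (-s))) := by ring
      _ ≤ _ := by gcongr
  have hint : |∫ s in t..x, g s| ≤ c * normSq a n := by
    calc _ ≤ ∫ s in uIoc t x, ‖g s‖ := intervalIntegral.norm_integral_le_integral_norm_uIoc
      _ ≤ ∫ s in uIoc t x, c * ((reduced a n).eval s ^ 2 * (s ^ a * Real.exp (-s))) :=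
          setIntegral_mono_on hcont.intervalIntegrable.def'.norm
            (((integrableOn_reduced_sq ha n).mono_set hsub0).const_mul c) measurableSet_uIoc hle
      _ ≤ c * normSq a n := by
          rw [integral_const_mul]
          gcongr
          exact setIntegral_reduced_sq_le ha n hsub0
  rw [hFTC] at hint
  linarith [le_abs_self (energy a n x - energy a n t)]

theorem energy_le (ha : -1 < a) {n : ℕ} (hn : n ≠ 0) {t : ℝ}
    (ht : t ∈ Icc ((n : ℝ) / 4) (15 * n / 4)) :
    energy a n t ≤ 4 ^ |a| * (n : ℝ) ^ a * (23 * (|a| + 1) * n ^ 2) *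
      ((reduced a n).eval t ^ 2 * (t ^ a * Real.exp (-t))
        + (reduced a (n - 1)).eval t ^ 2 * (t ^ a * Real.exp (-t))) := by
  have hn1 : (1 : ℝ) ≤ n := by exact_mod_cast Nat.one_le_iff_ne_zero.2 hn
  have ht0 : 0 < t := by linarith [ht.1]
  have ha0 := abs_nonneg a
  have h1 : t ^ a ≤ 4 ^ |a| * (n : ℝ) ^ a :=
    rpow_le_four_rpow_abs_mul ht0 (by linarith) (by linarith [ht.2]) (by linarith [ht.1]) a
  have e : t ^ (2 * a) = t ^ a * t ^ a := by rw [← Real.rpow_add ht0]; ring_nf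
  rw [energy, e]
  generalize eval t (reduced a n) = P at *
  generalize eval t (reduced a (n - 1)) = Q at *
  have h2 : (n * (P - Q) - t / 2 * P) ^ 2 + t * (n + (a + 1) / 2 - t / 4) * P ^ 2 ≤
      23 * (|a| + 1) * n ^ 2 * (P ^ 2 + Q ^ 2) := by
    have e1 : (n * (P - Q) - t / 2 * P) ^ 2 ≤
        3 * ((n * P) ^ 2 + (n * Q) ^ 2 + (t / 2 * P) ^ 2) := by
      nlinarith [sq_nonneg (n * P + n * Q), sq_nonneg (n * P + t / 2 * P),
        sq_nonneg (n * Q - t / 2 * P)]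
    have e2 : (t / 2 * P) ^ 2 ≤ (2 * n * P) ^ 2 := by
      rw [mul_pow, mul_pow]
      gcongr
      linarith [ht.2]
    have e3 : t * (n + (a + 1) / 2 - t / 4) ≤ (4 * n) * (2 * (|a| + 1) * n) := by
      have : n + (a + 1) / 2 - t / 4 ≤ 2 * (|a| + 1) * n := by nlinarith [le_abs_self a]
      have h0 : 0 ≤ n + (a + 1) / 2 - t / 4 := by linarith [ht.2]
      exact mul_le_mul (by linarith [ht.2]) this h0 (by linarith)
    have e4 := mul_le_mul_of_nonneg_right e3 (sq_nonneg P)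
    have e5 : 0 ≤ |a| * n ^ 2 * P ^ 2 := by positivity
    have e6 : 0 ≤ |a| * n ^ 2 * Q ^ 2 := by positivity
    have e7 : 0 ≤ (n * Q) ^ 2 := by positivity
    linarith
  calc _ = t ^ a * (((n * (P - Q) - t / 2 * P) ^ 2 + t * (n + (a + 1) / 2 - t / 4) * P ^ 2)
        * (t ^ a * Real.exp (-t))) := by ring
    _ ≤ t ^ a * ((23 * (|a| + 1) * n ^ 2 * (P ^ 2 + Q ^ 2)) * (t ^ a * Real.exp (-t))) := by
        gcongr
    _ ≤ (4 ^ |a| * (n : ℝ) ^ a) *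
        ((23 * (|a| + 1) * n ^ 2 * (P ^ 2 + Q ^ 2)) * (t ^ a * Real.exp (-t))) := by
        gcongr
    _ = _ := by ring

theorem energy_le_const (ha : -1 < a) {n : ℕ} (hn : n ≠ 0) {x : ℝ}
    (hx : x ∈ Icc ((n : ℝ) / 4) (15 * n / 4)) :
    energy a n x ≤ 4 ^ |a| * (n : ℝ) ^ a * (52 * (|a| + 1) ^ 2 * n) * normSq a n := by
  have hn1 : (1 : ℝ) ≤ n := by exact_mod_cast Nat.one_le_iff_ne_zero.2 hn
  have ha0 := abs_nonneg a
  have hm := normSq_pos ha n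
  set c := 4 ^ |a| * (n : ℝ) ^ a with hc
  have hc0 : 0 < c := by positivity
  set s := Icc ((n : ℝ) / 4) (15 * n / 4) with hs
  have hs0 : s ⊆ Ioi 0 := fun t ht => by
    have := ht.1
    simp only [mem_Ioi]
    linarith
  have hvol : volume.real s = 7 / 2 * n := by
    rw [hs, Real.volume_real_Icc_of_le (by linarith)]
    ring
  have hfin : volume s ≠ ⊤ := by simp [hs]
  have iP := (integrableOn_reduced_sq ha n).mono_set hs0
  have iQ := (integrableOn_reduced_sq ha (n - 1)).mono_set hs0
  have iPQ : IntegrableOn (fun t => c * (23 * (|a| + 1) * n ^ 2) *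
      ((reduced a n).eval t ^ 2 * (t ^ a * Real.exp (-t))
        + (reduced a (n - 1)).eval t ^ 2 * (t ^ a * Real.exp (-t)))) s :=
    (iP.add iQ).const_mul _
  have hmono : ∫ _ in s, energy a n x ≤ ∫ t in s, (c * (23 * (|a| + 1) * n ^ 2) *
      ((reduced a n).eval t ^ 2 * (t ^ a * Real.exp (-t))
        + (reduced a (n - 1)).eval t ^ 2 * (t ^ a * Real.exp (-t)))
      + c * (6 * (|a| + 1) ^ 2 * n) * normSq a n) := by
    refine setIntegral_mono_on (integrableOn_const hfin)
      (iPQ.add (integrableOn_const hfin)) measurableSet_Icc fun t ht => ?_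
    exact (energy_le_energy_add ha hn hx ht).trans (by gcongr; exact energy_le ha hn ht)
  rw [integral_add iPQ (integrableOn_const hfin), integral_const_mul,
    integral_add iP iQ, setIntegral_const, setIntegral_const, hvol, smul_eq_mul,
    smul_eq_mul] at hmono
  have hQ : normSq a (n - 1) ≤ (|a| + 1) * normSq a n := by
    have h := normSq_pred ha hn
    have : (n : ℝ) + a ≤ n * (|a| + 1) := by nlinarith [le_abs_self a]
    refine le_of_mul_le_mul_left ?_ (by linarith : (0 : ℝ) < n)
    rw [h, ← mul_assoc]
    gcongr
  have hbd := mul_le_mul_of_nonneg_left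
    (add_le_add (setIntegral_reduced_sq_le ha n hs0)
      ((setIntegral_reduced_sq_le ha (n - 1) hs0).trans hQ))
    (by positivity : 0 ≤ c * (23 * (|a| + 1) * (n : ℝ) ^ 2))
  refine le_of_mul_le_mul_left ?_ (by linarith : (0 : ℝ) < 7 / 2 * n)
  have hrest : (0 : ℝ) ≤ c * n ^ 2 * normSq a n * ((|a| + 1) ^ 2 - (|a| + 1)) :=
    mul_nonneg (by positivity) (by nlinarith)
  have hrest2 : (0 : ℝ) ≤ c * n ^ 2 * normSq a n * (|a| + 1) ^ 2 := by positivity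
  linarith

theorem reduced_sq_mul_exp_le (ha : -1 < a) : ∃ K : ℝ, 0 < K ∧ ∀ n : ℕ, n ≠ 0 →
    ∀ x ∈ Icc ((n : ℝ) / 4) (15 * n / 4),
      (reduced a n).eval x ^ 2 * Real.exp (-x) ≤ K * (n : ℝ) ^ (-(a + 1)) * normSq a n := by
  refine ⟨64 * (4 ^ |a|) ^ 3 * (52 * (|a| + 1) ^ 2), by positivity, fun n hn x hx => ?_⟩
  have hn1 : (1 : ℝ) ≤ n := by exact_mod_cast Nat.one_le_iff_ne_zero.2 hn
  have hn0 : (0 : ℝ) < n := by linarith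
  have hx0 : 0 < x := by linarith [hx.1]
  have hB : (n : ℝ) ^ a ≤ 4 ^ |a| * x ^ a :=
    rpow_le_four_rpow_abs_mul hn0 hx0 (by linarith [hx.1]) (by linarith [hx.2]) a
  have h := energy_le_const ha hn hx
  have e : x ^ (2 * a) = x ^ a * x ^ a := by rw [← Real.rpow_add hx0]; ring_nf
  set y := (reduced a n).eval x ^ 2 * Real.exp (-x) with hy
  have hy0 : 0 ≤ y := by positivity
  have hlow : (x ^ a) ^ 2 * ((n : ℝ) / 4 * (n / 16)) * y ≤ energy a n x := by
    rw [energy, e]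
    have h1 : (n : ℝ) / 4 * (n / 16) ≤ x * (n + (a + 1) / 2 - x / 4) :=
      mul_le_mul hx.1 (by linarith [hx.2]) (by positivity) hx0.le
    calc _ ≤ (x ^ a) ^ 2 * (x * (n + (a + 1) / 2 - x / 4)) * y := by gcongr
      _ ≤ (x ^ a) ^ 2 * (x * (n + (a + 1) / 2 - x / 4)) * y + x ^ a * x ^ a * Real.exp (-x) *
          (n * ((reduced a n).eval x - (reduced a (n - 1)).eval x)
            - x / 2 * (reduced a n).eval x) ^ 2 := le_add_of_nonneg_right (by positivity)
      _ = _ := by rw [hy]; ring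
  have hsq : ((n : ℝ) ^ a) ^ 2 ≤ (4 ^ |a|) ^ 2 * (x ^ a) ^ 2 := by
    rw [← mul_pow]; gcongr
  have hpow : (n : ℝ) ^ (-(a + 1)) = ((n : ℝ) ^ a * n)⁻¹ := by
    rw [Real.rpow_neg hn0.le, Real.rpow_add_one hn0.ne']
  rw [hpow]
  set ρ := (n : ℝ) ^ a with hρ
  have hρ0 : 0 < ρ := by positivity
  set B := (4 : ℝ) ^ |a| with hBd
  have hB0 : 0 < B := by positivity
  have hmain : ρ ^ 2 * n ^ 2 * y ≤ 64 * B ^ 3 * (52 * (|a| + 1) ^ 2) * (ρ * n) * normSq a n := by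
    calc _ ≤ (B ^ 2 * (x ^ a) ^ 2) * n ^ 2 * y := by gcongr
      _ = 64 * B ^ 2 * ((x ^ a) ^ 2 * ((n : ℝ) / 4 * (n / 16)) * y) := by ring
      _ ≤ 64 * B ^ 2 * (B * ρ * (52 * (|a| + 1) ^ 2 * n) * normSq a n) :=
          mul_le_mul_of_nonneg_left (hlow.trans h) (by positivity)
      _ = _ := by ring
  have hfin := mul_le_mul_of_nonneg_left hmain (by positivity : 0 ≤ ((ρ * n) ^ 2)⁻¹)
  calc y = ((ρ * n) ^ 2)⁻¹ * (ρ ^ 2 * n ^ 2 * y) := by field_simp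
    _ ≤ _ := hfin
    _ = _ := by field_simp

/-- The normalized Laguerre function in the variable `x = r²`. -/
noncomputable def profile (a : ℝ) (n : ℕ) (x : ℝ) : ℝ :=
  √(2 / normSq a n) * (reduced a n).eval x * Real.exp (-x / 2)

theorem laguerreFun_eq_profile (ha : -1 < a) (n : ℕ) (r : ℝ) :
    laguerreFun a n r = profile a n (r ^ 2) := by
  have hm := normSq_pos ha n
  have h1 : 2 * (n.factorial : ℝ) / Real.Gamma (n + a + 1) = 2 * normSq a n := by
    rw [normSq]; ring
  have h2 : Real.Gamma (n + a + 1) / n.factorial = (normSq a n)⁻¹ := by rw [normSq, inv_div]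
  have h3 : √(2 / normSq a n) = √(2 * normSq a n) * (normSq a n)⁻¹ := by
    have : 2 / normSq a n = 2 * normSq a n / normSq a n ^ 2 := by field_simp
    rw [this, Real.sqrt_div' _ (by positivity), Real.sqrt_sq hm.le]
    rfl
  rw [laguerreFun, laguerre_eq_eval_reduced, profile, h1, h2, h3]
  ring

theorem profile_sq (ha : -1 < a) (n : ℕ) (x : ℝ) :
    profile a n x ^ 2 = 2 / normSq a n * ((reduced a n).eval x ^ 2 * Real.exp (-x)) := by
  have hm := normSq_pos ha n
  have : Real.exp (-x / 2) ^ 2 = Real.exp (-x) := by rw [sq, ← Real.exp_add]; ring_nf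
  rw [profile, mul_pow, mul_pow, Real.sq_sqrt (by positivity), this]
  ring

theorem integrableOn_eval_mul_profile_sq (ha : -1 < a) (n : ℕ) (p : ℝ[X]) :
    IntegrableOn (fun x : ℝ => p.eval x * (profile a n x ^ 2 * x ^ a)) (Ioi 0) := by
  have h := (integrableOn_eval_mul_weight ha (p * (reduced a n * reduced a n))).const_mul
    (2 / normSq a n)
  refine IntegrableOn.congr_fun h (fun x _ => ?_) measurableSet_Ioi
  simp only [eval_mul, profile_sq ha]
  ring

theorem integral_eval_mul_profile_sq (ha : -1 < a) (n : ℕ) (p : ℝ[X]) :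
    ∫ x in Ioi (0 : ℝ), p.eval x * (profile a n x ^ 2 * x ^ a) =
      2 / normSq a n * moment a (p * (reduced a n * reduced a n)) := by
  rw [moment_eq_integral ha, ← integral_const_mul]
  refine setIntegral_congr_fun measurableSet_Ioi fun x _ => ?_
  simp only [eval_mul, profile_sq ha]
  ring

theorem integrableOn_profile_sq (ha : -1 < a) (n : ℕ) :
    IntegrableOn (fun x : ℝ => profile a n x ^ 2 * x ^ a) (Ioi 0) := by
  simpa using integrableOn_eval_mul_profile_sq ha n 1

theorem integral_profile_sq (ha : -1 < a) (n : ℕ) :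
    ∫ x in Ioi (0 : ℝ), profile a n x ^ 2 * x ^ a = 2 := by
  have h := integral_eval_mul_profile_sq ha n 1
  have hm := (normSq_pos ha n).ne'
  simp only [eval_one, one_mul, moment_reduced_sq ha] at h
  rw [h]
  field_simp

theorem integrableOn_abs_profile_rpow (ha : -1 < a) (n : ℕ) {q : ℝ} (hq1 : 1 ≤ q) (hq2 : q ≤ 2) :
    IntegrableOn (fun x : ℝ => |profile a n x| ^ q * x ^ a) (Ioi 0) := by
  have hm := normSq_pos ha n
  refine Integrable.mono' (integrableOn_eval_mul ha (b := 1 / 2) (by norm_num)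
    (1 + C (2 / normSq a n) * reduced a n ^ 2)) ?_ ?_
  · refine ContinuousOn.aestronglyMeasurable (fun x (hx : 0 < x) => ?_) measurableSet_Ioi
    refine ContinuousAt.continuousWithinAt ?_
    have h1 := Real.continuousAt_rpow_const x a (Or.inl hx.ne')
    have h2 := (reduced a n).continuous.continuousAt (x := x)
    have h3 : ContinuousAt (fun x => |profile a n x|) x := by
      unfold profile
      fun_prop
    exact (h3.rpow_const (Or.inr (by linarith))).mul h1
  · filter_upwards [ae_restrict_mem measurableSet_Ioi] with x (hx : 0 < x)
    set u := |√(2 / normSq a n) * (reduced a n).eval x| with hu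
    have hu0 : 0 ≤ u := abs_nonneg _
    have husq : u ^ 2 = 2 / normSq a n * (reduced a n).eval x ^ 2 := by
      rw [hu, sq_abs, mul_pow, Real.sq_sqrt (by positivity)]
    have h1 : u ^ q ≤ 1 + u ^ 2 := by
      rcases le_total u 1 with h | h
      · have := Real.rpow_le_one hu0 h (by linarith : 0 ≤ q)
        nlinarith
      · have := Real.rpow_le_rpow_of_exponent_le h hq2
        rw [Real.rpow_two] at this
        linarith
    have h2 : Real.exp (-x / 2) ^ q ≤ Real.exp (-(1 / 2) * x) := by
      rw [← Real.exp_mul, Real.exp_le_exp]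
      nlinarith
    rw [Real.norm_of_nonneg (by positivity), profile, abs_mul, ← hu, Real.abs_exp,
      Real.mul_rpow hu0 (Real.exp_pos _).le]
    simp only [eval_add, eval_one, eval_mul, eval_C, eval_pow]
    rw [← husq]
    calc _ ≤ (1 + u ^ 2) * Real.exp (-(1 / 2) * x) * x ^ a := by gcongr
      _ = _ := by ring

theorem rpow_le_mul_sq_add {q t A W : ℝ} (hq1 : 1 ≤ q) (hq2 : q ≤ 2) (ht : 0 ≤ t) (hA : 0 < A)
    (hW : 1 ≤ W) : t ^ q ≤ A ^ (q - 2) * W * t ^ 2 + A ^ q * W⁻¹ := by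
  have hW0 : 0 < W := by linarith
  have hT : 0 < A * W⁻¹ := by positivity
  rcases le_total t (A * W⁻¹) with h | h
  · have h1 : t ^ q ≤ A ^ q * W⁻¹ := by
      calc t ^ q ≤ (A * W⁻¹) ^ q := Real.rpow_le_rpow ht h (by linarith)
        _ = A ^ q * W⁻¹ ^ q := Real.mul_rpow hA.le (by positivity)
        _ ≤ A ^ q * W⁻¹ ^ (1 : ℝ) := by
            gcongr 1
            exact Real.rpow_le_rpow_of_exponent_ge (by positivity) (inv_le_one_of_one_le₀ hW) hq1
        _ = _ := by rw [Real.rpow_one]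
    have h2 : 0 ≤ A ^ (q - 2) * W * t ^ 2 := by positivity
    linarith
  · have ht0 : 0 < t := hT.trans_le h
    have h1 : t ^ q ≤ A ^ (q - 2) * W * t ^ 2 := by
      calc t ^ q = t ^ (q - 2) * t ^ 2 := by
            rw [← Real.rpow_two, ← Real.rpow_add ht0]; ring_nf
        _ ≤ (A * W⁻¹) ^ (q - 2) * t ^ 2 := by
            gcongr 1
            exact Real.rpow_le_rpow_of_nonpos hT h (by linarith)
        _ = A ^ (q - 2) * W ^ (2 - q) * t ^ 2 := by
            rw [Real.mul_rpow hA.le (by positivity), Real.inv_rpow hW0.le, ← Real.rpow_neg hW0.le,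
              neg_sub]
        _ ≤ A ^ (q - 2) * W ^ (1 : ℝ) * t ^ 2 := by
            gcongr
            linarith
        _ = _ := by rw [Real.rpow_one]
    have h2 : 0 ≤ A ^ q * W⁻¹ := by positivity
    linarith

theorem integral_abs_profile_rpow_le (ha : -1 < a) {q : ℝ} (hq1 : 1 ≤ q) (hq2 : q ≤ 2) :
    ∃ K : ℝ, 0 < K ∧ ∀ n : ℕ, n ≠ 0 →
      ∫ x in Ioi (0 : ℝ), |profile a n x| ^ q * x ^ a ≤ K * (n : ℝ) ^ ((a + 1) * (1 - q / 2)) := by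
  obtain ⟨m, hm⟩ := exists_nat_gt (a + 1)
  obtain ⟨K, hK, hmom⟩ := moment_X_pow_even_le ha m
  have ha1 : 0 < a + 1 := by linarith
  have hd : 0 < 2 * m - (a + 1) := by linarith
  refine ⟨(2 + 1 / (a + 1)) + (2 * K * 2 ^ (2 * m) + 1 / (2 * m - (a + 1))), by positivity,
    fun n hn => ?_⟩
  have hn1 : (1 : ℝ) ≤ n := by exact_mod_cast Nat.one_le_iff_ne_zero.2 hn
  have hn0 : (0 : ℝ) < n := by linarith
  set A : ℝ := (n : ℝ) ^ (-((a + 1) / 2)) with hA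
  have hA0 : 0 < A := by positivity
  set Y : ℝ := (n : ℝ) ^ ((a + 1) * (1 - q / 2)) with hY
  have hY0 : 0 < Y := by positivity
  have hAY : A ^ (q - 2) = Y := by
    rw [hA, hY, ← Real.rpow_mul hn0.le]; ring_nf
  have hAqY : A ^ q * (n : ℝ) ^ (a + 1) = Y := by
    rw [hA, hY, ← Real.rpow_mul hn0.le, ← Real.rpow_add hn0]; ring_nf
  have hint := integrableOn_abs_profile_rpow ha n hq1 hq2
  have hsq := integrableOn_profile_sq ha n
  have hsub1 : Ioc (0 : ℝ) n ⊆ Ioi 0 := Ioc_subset_Ioi_self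
  have hsub2 : Ioi (n : ℝ) ⊆ Ioi 0 := Ioi_subset_Ioi hn0.le
  have hunion : Ioi (0 : ℝ) = Ioc 0 (n : ℝ) ∪ Ioi (n : ℝ) := (Ioc_union_Ioi_eq_Ioi hn0.le).symm
  have hnear : ∫ x in Ioc (0 : ℝ) n, |profile a n x| ^ q * x ^ a ≤ (2 + 1 / (a + 1)) * Y := by
    have hpow : IntegrableOn (fun x : ℝ => x ^ a) (Ioc 0 (n : ℝ)) :=
      (intervalIntegral.intervalIntegrable_rpow' ha).1
    have hval : ∫ x in Ioc (0 : ℝ) n, x ^ a = (n : ℝ) ^ (a + 1) / (a + 1) := by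
      rw [← intervalIntegral.integral_of_le hn0.le, integral_rpow (Or.inl ha),
        Real.zero_rpow ha1.ne', sub_zero]
    have hle : ∫ x in Ioc (0 : ℝ) n, profile a n x ^ 2 * x ^ a ≤ 2 := by
      rw [← integral_profile_sq ha n]
      refine setIntegral_mono_set hsq ?_ hsub1.eventuallyLE
      filter_upwards [ae_restrict_mem measurableSet_Ioi] with x (hx : 0 < x)
      simp only [Pi.zero_apply]
      positivity
    calc _ ≤ ∫ x in Ioc (0 : ℝ) n, (Y * (profile a n x ^ 2 * x ^ a) + A ^ q * x ^ a) := by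
          refine setIntegral_mono_on (hint.mono_set hsub1)
            (((hsq.mono_set hsub1).const_mul _).add (hpow.const_mul _)) measurableSet_Ioc
            fun x hx => ?_
          have h := rpow_le_mul_sq_add hq1 hq2 (abs_nonneg (profile a n x)) hA0 le_rfl
          rw [sq_abs, hAY] at h
          have hx0 : 0 ≤ x ^ a := Real.rpow_nonneg hx.1.le _
          refine (mul_le_mul_of_nonneg_right h hx0).trans_eq ?_
          ring
      _ = Y * (∫ x in Ioc (0 : ℝ) n, profile a n x ^ 2 * x ^ a)
          + A ^ q * ((n : ℝ) ^ (a + 1) / (a + 1)) := by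
          rw [integral_add ((hsq.mono_set hsub1).const_mul _) (hpow.const_mul _),
            integral_const_mul, integral_const_mul, hval]
      _ ≤ Y * 2 + A ^ q * ((n : ℝ) ^ (a + 1) / (a + 1)) := by gcongr
      _ = (2 + 1 / (a + 1)) * Y := by
          rw [← mul_div_assoc, hAqY]; ring
  have hfar : ∫ x in Ioi (n : ℝ), |profile a n x| ^ q * x ^ a
      ≤ (2 * K * 2 ^ (2 * m) + 1 / (2 * m - (a + 1))) * Y := by
    have hmi := integrableOn_eval_mul_profile_sq ha n (X ^ (2 * m))
    simp only [eval_pow, eval_X] at hmi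
    have hlt : a - 2 * m < -1 := by linarith
    have hpow := integrableOn_Ioi_rpow_of_lt hlt hn0
    have hval := integral_Ioi_rpow_of_lt hlt hn0
    have hle : ∫ x in Ioi (n : ℝ), x ^ (2 * m) * (profile a n x ^ 2 * x ^ a)
        ≤ 2 * K * 2 ^ (2 * m) * n ^ (2 * m) := by
      have hN := normSq_pos ha n
      calc _ ≤ ∫ x in Ioi (0 : ℝ), x ^ (2 * m) * (profile a n x ^ 2 * x ^ a) := by
            refine setIntegral_mono_set hmi ?_ hsub2.eventuallyLE
            filter_upwards [ae_restrict_mem measurableSet_Ioi] with x (hx : 0 < x)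
            simp only [Pi.zero_apply]
            positivity
        _ = 2 / normSq a n * moment a (X ^ (2 * m) * (reduced a n * reduced a n)) := by
            rw [← integral_eval_mul_profile_sq ha n]
            simp only [eval_pow, eval_X]
        _ ≤ 2 / normSq a n * (K * (n + 1) ^ (2 * m) * normSq a n) := by gcongr; exact hmom n
        _ = 2 * K * (n + 1) ^ (2 * m) := by field_simp
        _ ≤ 2 * K * (2 * n) ^ (2 * m) := by gcongr; linarith
        _ = _ := by rw [mul_pow]; ring
    calc _ ≤ ∫ x in Ioi (n : ℝ), (Y / n ^ (2 * m) * (x ^ (2 * m) * (profile a n x ^ 2 * x ^ a))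
          + A ^ q * n ^ (2 * m) * x ^ (a - 2 * m)) := by
          refine setIntegral_mono_on (hint.mono_set hsub2)
            (((hmi.mono_set hsub2).const_mul _).add (hpow.const_mul _)) measurableSet_Ioi
            fun x (hx : (n : ℝ) < x) => ?_
          have hx0 : 0 < x := hn0.trans hx
          have hW : 1 ≤ (x / n) ^ (2 * m) := one_le_pow₀ ((one_le_div hn0).2 hx.le)
          have h := rpow_le_mul_sq_add hq1 hq2 (abs_nonneg (profile a n x)) hA0 hW
          rw [sq_abs, hAY] at h
          have e : x ^ (a - 2 * m) = x ^ a / x ^ (2 * m) := by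
            rw [Real.rpow_sub hx0, ← Real.rpow_natCast x (2 * m)]; push_cast; rfl
          refine (mul_le_mul_of_nonneg_right h (Real.rpow_nonneg hx0.le a)).trans_eq ?_
          rw [e, div_pow]
          field_simp
      _ = Y / n ^ (2 * m) * (∫ x in Ioi (n : ℝ), x ^ (2 * m) * (profile a n x ^ 2 * x ^ a))
          + A ^ q * n ^ (2 * m) * (-(n : ℝ) ^ (a - 2 * m + 1) / (a - 2 * m + 1)) := by
          rw [integral_add ((hmi.mono_set hsub2).const_mul _) (hpow.const_mul _),
            integral_const_mul, integral_const_mul, hval]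
      _ ≤ Y / n ^ (2 * m) * (2 * K * 2 ^ (2 * m) * n ^ (2 * m))
          + A ^ q * n ^ (2 * m) * (-(n : ℝ) ^ (a - 2 * m + 1) / (a - 2 * m + 1)) := by gcongr
      _ = (2 * K * 2 ^ (2 * m) + 1 / (2 * m - (a + 1))) * Y := by
          have e : (n : ℝ) ^ (a - 2 * m + 1) = (n : ℝ) ^ (a + 1) / n ^ (2 * m) := by
            rw [show a - 2 * m + 1 = (a + 1) - ((2 * m : ℕ) : ℝ) by push_cast; ring,
              Real.rpow_sub hn0, Real.rpow_natCast]
          have e2 : a - 2 * m + 1 = -(2 * m - (a + 1)) := by ring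
          rw [e, e2, neg_div_neg_eq, ← hAqY]
          field_simp
  rw [hunion, setIntegral_union (Ioc_disjoint_Ioi le_rfl) measurableSet_Ioi
    (hint.mono_set hsub1) (hint.mono_set hsub2), add_mul]
  exact add_le_add hnear hfar

theorem quarter_le_integral_profile_sq (ha : -1 < a) {n : ℕ} (hn : 8 * (a + 2) ≤ n) :
    1 / 4 ≤ ∫ x in Icc ((n : ℝ) / 4) (15 * n / 4), profile a n x ^ 2 * x ^ a := by
  have hn1 : (8 : ℝ) ≤ n := by linarith
  have hn' : n ≠ 0 := by rintro rfl; norm_num at hn1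
  have hm := normSq_pos ha n
  set s := Icc ((n : ℝ) / 4) (15 * n / 4) with hs
  have hs0 : s ⊆ Ioi 0 := fun t ht => by
    have := ht.1
    simp only [mem_Ioi]
    linarith
  have hval : ∫ x in Ioi (0 : ℝ), (C (4 * (n : ℝ)) * X - X ^ 2 : ℝ[X]).eval x *
      (profile a n x ^ 2 * x ^ a)
      = 2 * (4 * n * (2 * n + a + 1)
        - ((n + 1) * (n + a + 1) + (2 * n + a + 1) ^ 2 + n * (n + a))) := by
    rw [integral_eval_mul_profile_sq ha, sub_mul, map_sub, mul_assoc, moment_C_mul,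
      moment_X_mul_reduced_sq ha hn', moment_X_sq_mul_reduced_sq ha hn']
    field_simp
  have hsq := integrableOn_profile_sq ha n
  have hind : IntegrableOn (s.indicator fun x : ℝ => profile a n x ^ 2 * x ^ a) (Ioi 0) :=
    hsq.indicator measurableSet_Icc
  have hle : ∫ x in Ioi (0 : ℝ), (C (4 * (n : ℝ)) * X - X ^ 2 : ℝ[X]).eval x *
      (profile a n x ^ 2 * x ^ a) ≤ ∫ x in Ioi (0 : ℝ), ((n : ℝ) ^ 2 * (profile a n x ^ 2 * x ^ a)
        + 4 * n ^ 2 * s.indicator (fun x : ℝ => profile a n x ^ 2 * x ^ a) x) := by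
    refine setIntegral_mono_on (integrableOn_eval_mul_profile_sq ha n _)
      ((hsq.const_mul _).add (hind.const_mul _)) measurableSet_Ioi fun x (hx : 0 < x) => ?_
    simp only [eval_sub, eval_mul, eval_C, eval_X, eval_pow]
    have h0 : 0 ≤ profile a n x ^ 2 * x ^ a := by positivity
    by_cases hxs : x ∈ s
    · rw [indicator_of_mem hxs]
      nlinarith [mul_nonneg h0 (sq_nonneg (x - 2 * n)), mul_nonneg h0 (sq_nonneg (n : ℝ))]
    · rw [indicator_of_notMem hxs, mul_zero, add_zero]
      refine mul_le_mul_of_nonneg_right ?_ h0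
      rcases lt_or_ge x ((n : ℝ) / 4) with h | h
      · nlinarith
      · have : 15 * (n : ℝ) / 4 < x := by
          by_contra! h'
          exact hxs ⟨h, h'⟩
        nlinarith
  rw [hval, integral_add (hsq.const_mul _) (hind.const_mul _), integral_const_mul,
    integral_const_mul, integral_profile_sq ha, setIntegral_indicator measurableSet_Icc,
    inter_eq_self_of_subset_right hs0] at hle
  generalize ∫ x in s, profile a n x ^ 2 * x ^ a = I at hle
  have hb : 0 < a + 1 := by linarith
  have h1 : (n : ℝ) ^ 2 * 3 ≤ n ^ 2 * 2 + 4 * n ^ 2 * I := by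
    refine le_trans ?_ hle
    nlinarith [mul_nonneg (by linarith : (0 : ℝ) ≤ n - 8 * (a + 2)) (by linarith : (0 : ℝ) ≤ n),
      mul_nonneg (by linarith : (0 : ℝ) ≤ n - 8 * (a + 2)) hb.le, mul_nonneg hb.le hb.le]
  have h2 : (0 : ℝ) < n ^ 2 := by positivity
  nlinarith

theorem le_integral_abs_profile_rpow (ha : -1 < a) {q : ℝ} (hq1 : 1 ≤ q) (hq2 : q ≤ 2) :
    ∃ c : ℝ, 0 < c ∧ ∀ n : ℕ, 8 * (a + 2) ≤ n →
      c * (n : ℝ) ^ ((a + 1) * (1 - q / 2)) ≤ ∫ x in Ioi (0 : ℝ), |profile a n x| ^ q * x ^ a := by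
  obtain ⟨K, hK, hsup⟩ := reduced_sq_mul_exp_le ha
  refine ⟨1 / 4 * ((2 * K) ^ (1 - q / 2))⁻¹, by positivity, fun n hn => ?_⟩
  have hn0 : (0 : ℝ) < n := by linarith
  have hn' : n ≠ 0 := by rintro rfl; simp at hn0
  have hm := normSq_pos ha n
  set s := Icc ((n : ℝ) / 4) (15 * n / 4) with hs
  have hs0 : s ⊆ Ioi 0 := fun t ht => by
    have := ht.1
    simp only [mem_Ioi]
    linarith
  have hint := integrableOn_abs_profile_rpow ha n hq1 hq2
  set S := (2 * K * (n : ℝ) ^ (-(a + 1))) ^ (1 - q / 2) with hS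
  have hSeq : S = (2 * K) ^ (1 - q / 2) * ((n : ℝ) ^ ((a + 1) * (1 - q / 2)))⁻¹ := by
    rw [hS, Real.mul_rpow (by positivity) (by positivity), ← Real.rpow_mul hn0.le, neg_mul,
      Real.rpow_neg hn0.le]
  have hle : (1 : ℝ) / 4 ≤ S * ∫ x in Ioi (0 : ℝ), |profile a n x| ^ q * x ^ a := by
    calc (1 : ℝ) / 4 ≤ ∫ x in s, profile a n x ^ 2 * x ^ a := quarter_le_integral_profile_sq ha hn
      _ ≤ ∫ x in s, S * (|profile a n x| ^ q * x ^ a) := by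
          refine setIntegral_mono_on ((integrableOn_profile_sq ha n).mono_set hs0)
            ((hint.mono_set hs0).const_mul S) measurableSet_Icc fun x hx => ?_
          have hx0 : 0 < x := hs0 hx
          have hf : profile a n x ^ 2 ≤ 2 * K * (n : ℝ) ^ (-(a + 1)) := by
            rw [profile_sq ha]
            calc _ ≤ 2 / normSq a n * (K * (n : ℝ) ^ (-(a + 1)) * normSq a n) :=
                  mul_le_mul_of_nonneg_left (hsup n hn' x hx) (by positivity)
              _ = _ := by field_simp
          rw [← mul_assoc]
          refine mul_le_mul_of_nonneg_right ?_ (Real.rpow_nonneg hx0.le a)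
          have h1 : (profile a n x ^ 2) ^ (1 - q / 2) ≤ S :=
            Real.rpow_le_rpow (sq_nonneg _) hf (by linarith)
          have h2 : profile a n x ^ 2 = (profile a n x ^ 2) ^ (1 - q / 2) * |profile a n x| ^ q := by
            have e : |profile a n x| ^ q = (profile a n x ^ 2) ^ (q / 2) := by
              rw [← sq_abs, ← Real.rpow_two, ← Real.rpow_mul (abs_nonneg _)]
              ring_nf
            rw [e, ← Real.rpow_add_of_nonneg (sq_nonneg _) (by linarith) (by linarith)]
            norm_num
          calc _ = _ := h2
            _ ≤ _ := by gcongr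
      _ ≤ ∫ x in Ioi (0 : ℝ), S * (|profile a n x| ^ q * x ^ a) := by
          refine setIntegral_mono_set (hint.const_mul S) ?_ hs0.eventuallyLE
          filter_upwards [ae_restrict_mem measurableSet_Ioi] with x (hx : 0 < x)
          simp only [Pi.zero_apply]
          positivity
      _ = _ := integral_const_mul _ _
  rw [hSeq] at hle
  set Y := (n : ℝ) ^ ((a + 1) * (1 - q / 2))
  have hY : 0 < Y := by positivity
  have hR : 0 < (2 * K) ^ (1 - q / 2) := by positivity
  calc _ ≤ ((2 * K) ^ (1 - q / 2) * Y⁻¹ * ∫ x in Ioi (0 : ℝ), |profile a n x| ^ q * x ^ a)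
        * ((2 * K) ^ (1 - q / 2))⁻¹ * Y := by gcongr
    _ = _ := by field_simp

theorem integral_abs_laguerreFun_rpow (ha : -1 < a) (n : ℕ) (q : ℝ) :
    ∫ r in Ioi (0 : ℝ), |laguerreFun a n r| ^ q * r ^ (2 * a + 1) =
      1 / 2 * ∫ x in Ioi (0 : ℝ), |profile a n x| ^ q * x ^ a := by
  rw [← integral_comp_rpow_Ioi_of_pos (g := fun x => |profile a n x| ^ q * x ^ a) (p := 2) two_pos,
    ← integral_const_mul]
  refine setIntegral_congr_fun measurableSet_Ioi fun r (hr : 0 < r) => ?_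
  simp only [laguerreFun_eq_profile ha, smul_eq_mul, Real.rpow_two]
  rw [← Real.rpow_natCast_mul hr.le, Real.rpow_add_one hr.ne',
    show (2 : ℝ) - 1 = 1 by norm_num, Real.rpow_one]
  push_cast
  ring

theorem laguerreFun_Lq_norm_of_neg_one_lt (ha : -1 < a) {q : ℝ} (hq1 : 1 ≤ q) (hq2 : q ≤ 2) :
    ∃ c C : ℝ, 0 < c ∧ 0 < C ∧ ∃ N : ℕ, ∀ n : ℕ, N ≤ n →
      c * (n : ℝ) ^ ((a + 1) * (1 / q - 1 / 2)) ≤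
          (∫ r in Ioi (0 : ℝ), |laguerreFun a n r| ^ q * r ^ (2 * a + 1)) ^ (1 / q) ∧
      (∫ r in Ioi (0 : ℝ), |laguerreFun a n r| ^ q * r ^ (2 * a + 1)) ^ (1 / q) ≤
        C * (n : ℝ) ^ ((a + 1) * (1 / q - 1 / 2)) := by
  obtain ⟨K, hK, hup⟩ := integral_abs_profile_rpow_le ha hq1 hq2
  obtain ⟨c, hc, hlow⟩ := le_integral_abs_profile_rpow ha hq1 hq2
  obtain ⟨N, hN⟩ := exists_nat_ge (8 * (a + 2))
  refine ⟨(1 / 2 * c) ^ (1 / q), (1 / 2 * K) ^ (1 / q), by positivity, by positivity, N,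
    fun n hn => ?_⟩
  have hn8 : 8 * (a + 2) ≤ n := hN.trans (by exact_mod_cast hn)
  have hn0 : (0 : ℝ) < n := by linarith
  have hn' : n ≠ 0 := by rintro rfl; simp at hn0
  have hq0 : 0 < q := by linarith
  have hpow : (n : ℝ) ^ ((a + 1) * (1 / q - 1 / 2))
      = ((n : ℝ) ^ ((a + 1) * (1 - q / 2))) ^ (1 / q) := by
    rw [← Real.rpow_mul hn0.le]
    congr 1
    field_simp
  have hl := hlow n hn8
  have hu := hup n hn'
  rw [integral_abs_laguerreFun_rpow ha, hpow, ← Real.mul_rpow (by positivity) (by positivity),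
    ← Real.mul_rpow (by positivity) (by positivity)]
  have hY : 0 < (n : ℝ) ^ ((a + 1) * (1 - q / 2)) := by positivity
  have hcY := mul_pos hc hY
  constructor <;> refine Real.rpow_le_rpow ?_ ?_ (by positivity) <;> nlinarith

end Laguerre

/-- ‖φ_n^{|α|₁+d-1}‖_{L^q((0,∞), r^{2|α|₁+2d-1}dr)} ∼ n^{(|α|₁+d)(1/q-1/2)} for large n. -/
theorem laguerreFun_Lq_norm (d : ℕ) (hd : 0 < d) (α : Fin d → ℝ) (hα : ∀ i, -1 < α i)
    (q : ℝ) (hq1 : 1 ≤ q) (hq2 : q ≤ 2) :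
    ∃ c C : ℝ, 0 < c ∧ 0 < C ∧ ∃ N : ℕ, ∀ n : ℕ, N ≤ n →
      c * (n : ℝ) ^ (((∑ i, α i) + d) * (1 / q - 1 / 2)) ≤
          (∫ r in Set.Ioi (0 : ℝ),
              |laguerreFun ((∑ i, α i) + d - 1) n r| ^ q *
                r ^ (2 * (∑ i, α i) + 2 * d - 1)) ^ (1 / q) ∧
      (∫ r in Set.Ioi (0 : ℝ),
          |laguerreFun ((∑ i, α i) + d - 1) n r| ^ q *
            r ^ (2 * (∑ i, α i) + 2 * d - 1)) ^ (1 / q) ≤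
        C * (n : ℝ) ^ (((∑ i, α i) + d) * (1 / q - 1 / 2)) := by
  have hpos : 0 < ∑ i, (α i + 1) :=
    Finset.sum_pos (fun i _ => by linarith [hα i]) ⟨⟨0, hd⟩, Finset.mem_univ _⟩
  rw [Finset.sum_add_distrib] at hpos
  simp only [Finset.sum_const, Finset.card_univ, Fintype.card_fin, nsmul_eq_mul, mul_one] at hpos
  have h := Laguerre.laguerreFun_Lq_norm_of_neg_one_lt
    (a := (∑ i, α i) + d - 1) (by linarith) hq1 hq2
  rwa [sub_add_cancel, show 2 * ((∑ i, α i) + d - 1) + 1 = 2 * (∑ i, α i) + 2 * d - 1 by ring] at h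
end
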